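/- arXiv:1809.00527 — 5 statements merged into one kernel-verified Lean document; each statement's English description precedes it below -/
import Mathlib

section
/- Let n ≥ 2 and v ≥ 2, and let G be a strongly (n,v)-clique-partitioned simple graph. Then the number of edges of G is at most n·v·(v-1)/2 + n·v·(n-1)·(v-2)/2 (equivalently, at most n·v·(n·v - 2·n + 1)/2). -/
open SimpleGraph Finset

/-- A decomposition of the vertex set of `G` into `n` pairwise disjoint `v`-cliques. -/
def IsCliquePartition {V : Type} [Fintype V] [DecidableEq V] (G : SimpleGraph V)
    (n v : ℕ) (P : Finset (Finset V)) : Prop :=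
  P.card = n ∧ (∀ s ∈ P, G.IsNClique v s) ∧
    (∀ s ∈ P, ∀ t ∈ P, s ≠ t → Disjoint s t) ∧ P.biUnion id = Finset.univ

/-- `G` is weakly `(n,v)`-clique-partitioned: it has `n*v` vertices and its vertex set
can be decomposed in exactly one way into `n` pairwise disjoint `v`-cliques. -/
def WeaklyCP {V : Type} [Fintype V] [DecidableEq V] (G : SimpleGraph V) (n v : ℕ) : Prop :=
  Fintype.card V = n * v ∧ ∃! P : Finset (Finset V), IsCliquePartition G n v P

/-- `G` is strongly `(n,v)`-clique-partitioned: weakly so, and moreover the only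
`v`-cliques of `G` are the `n` cliques of the (unique) decomposition. -/
def StronglyCP {V : Type} [Fintype V] [DecidableEq V] (G : SimpleGraph V) (n v : ℕ) : Prop :=
  WeaklyCP G n v ∧
    ∀ P : Finset (Finset V), IsCliquePartition G n v P →
      ∀ s : Finset V, G.IsNClique v s → s ∈ P

namespace StronglyCP

variable {V : Type} [Fintype V] [DecidableEq V] {G : SimpleGraph V} {n v : ℕ}
  {P : Finset (Finset V)}

/-- A vertex outside a clique of the decomposition has at most `v - 2` neighbours in it. -/
theorem card_neighborFinset_inter_le [DecidableRel G.Adj] (hG : StronglyCP G n v) (hv : 2 ≤ v)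
    (hP : IsCliquePartition G n v P) {s : Finset V} (hs : s ∈ P) {x : V} (hx : x ∉ s) :
    (G.neighborFinset x ∩ s).card ≤ v - 2 := by
  by_contra! h
  obtain ⟨t, ht, htcard⟩ := Finset.exists_subset_card_eq (show v - 1 ≤ (G.neighborFinset x ∩ s).card by omega)
  have htadj : ∀ y ∈ t, G.Adj x y := fun y hy ↦ by
    simpa using (Finset.mem_inter.1 (ht hy)).1
  have hts : t ⊆ s := ht.trans Finset.inter_subset_right
  have hclique : G.IsNClique (v - 1 + 1) (insert x t) :=
    SimpleGraph.IsNClique.insert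
      ⟨(hP.2.1 s hs).isClique.subset (by exact_mod_cast hts), htcard⟩ htadj
  rw [Nat.sub_add_cancel (by omega)] at hclique
  have hne : insert x t ≠ s := fun h ↦ hx (h ▸ Finset.mem_insert_self x t)
  have hdisj := hP.2.2.1 _ (hG.2 P hP _ hclique) s hs hne
  obtain ⟨y, hy⟩ := Finset.card_pos.1 (show 0 < t.card by omega)
  exact Finset.disjoint_left.1 hdisj (Finset.mem_insert_of_mem hy) (hts hy)

theorem degree_le [DecidableRel G.Adj] (hG : StronglyCP G n v) (hv : 2 ≤ v) (x : V) :
    G.degree x ≤ (v - 1) + (n - 1) * (v - 2) := by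
  obtain ⟨P, hP, -⟩ := hG.1.2
  obtain ⟨s, hs, hxs⟩ : ∃ s ∈ P, x ∈ s := by
    simpa using hP.2.2.2.ge (Finset.mem_univ x)
  have hcover : G.neighborFinset x ⊆ P.biUnion fun t ↦ G.neighborFinset x ∩ t := by
    rw [← Finset.inter_biUnion]
    exact Finset.subset_inter subset_rfl (hP.2.2.2.symm ▸ Finset.subset_univ _)
  have hown : (G.neighborFinset x ∩ s).card ≤ v - 1 := by
    rw [← (hP.2.1 s hs).card_eq, ← Finset.card_erase_of_mem hxs]
    refine Finset.card_le_card fun y hy ↦ ?_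
    rw [Finset.mem_inter, SimpleGraph.mem_neighborFinset] at hy
    exact Finset.mem_erase.2 ⟨hy.1.ne', hy.2⟩
  have hother : ∀ t ∈ P.erase s, (G.neighborFinset x ∩ t).card ≤ v - 2 := fun t ht ↦ by
    obtain ⟨hne, htP⟩ := Finset.mem_erase.1 ht
    exact hG.card_neighborFinset_inter_le hv hP htP
      (Finset.disjoint_left.1 (hP.2.2.1 s hs t htP hne.symm) hxs)
  calc G.degree x ≤ ∑ t ∈ P, (G.neighborFinset x ∩ t).card :=
        (Finset.card_le_card hcover).trans Finset.card_biUnion_le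
    _ = (G.neighborFinset x ∩ s).card + ∑ t ∈ P.erase s, (G.neighborFinset x ∩ t).card :=
        (Finset.add_sum_erase P _ hs).symm
    _ ≤ (v - 1) + (P.erase s).card * (v - 2) :=
        add_le_add hown (by simpa using Finset.sum_le_card_nsmul _ _ _ hother)
    _ = (v - 1) + (n - 1) * (v - 2) := by rw [Finset.card_erase_of_mem hs, hP.1]

end StronglyCP

/-- If `G` is a strongly `(n,v)`-clique-partitioned graph (`n,v ≥ 2`),
then `G` has at most `n·v·(v-1)/2 + n·v·(n-1)·(v-2)/2` edges. -/
theorem strongly_cp_edge_bound {V : Type} [Fintype V] [DecidableEq V]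
    (n v : ℕ) (hn : 2 ≤ n) (hv : 2 ≤ v) (G : SimpleGraph V)
    (hG : StronglyCP G n v) :
    Nat.card G.edgeSet ≤ n * v * (v - 1) / 2 + n * v * (n - 1) * (v - 2) / 2 := by
  classical
  have hsum : 2 * G.edgeFinset.card ≤ n * v * ((v - 1) + (n - 1) * (v - 2)) := by
    rw [← G.sum_degrees_eq_twice_card_edges, ← hG.1.1, ← Finset.card_univ, ← smul_eq_mul]
    exact Finset.sum_le_card_nsmul _ _ _ fun x _ ↦ hG.degree_le hv x
  rw [mul_add, ← mul_assoc] at hsum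
  have heven : 2 ∣ n * v * (v - 1) := by
    rw [mul_assoc]
    exact (Nat.even_mul_pred_self v).two_dvd.mul_left n
  rw [Nat.card_eq_fintype_card, ← SimpleGraph.edgeFinset_card]
  omega
end

section
/- Up to isomorphism, there are precisely two strongly (3,4)-clique-partitioned graphs with exactly 18 + 24 = 42 edges (the maximum possible); that is, there exist exactly two isomorphism classes of maximal strongly (3,4)-clique-partitioned graphs. -/
open SimpleGraph Finset

open Equiv (Perm swap)

/-- A partition into `v`-cliques that contains all `v`-cliques is the only such partition. -/
theorem StronglyCP.of_isCliquePartition {V : Type} [Fintype V] [DecidableEq V]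
    {G : SimpleGraph V} {n v : ℕ} {P : Finset (Finset V)} (hV : Fintype.card V = n * v)
    (hP : IsCliquePartition G n v P) (h : ∀ s, G.IsNClique v s → s ∈ P) : StronglyCP G n v := by
  have huniq : ∀ Q, IsCliquePartition G n v Q → Q = P := fun Q hQ ↦
    eq_of_subset_of_card_le (fun s hs ↦ h s (hQ.2.1 s hs)) (hP.1.trans hQ.1.symm).le
  exact ⟨⟨hV, P, hP, huniq⟩, fun Q hQ s hs ↦ huniq Q hQ ▸ h s hs⟩

/-- The bipartite adjacency matrix of an 8-cycle. -/
def cycleMatrix (i j : Fin 4) : Bool := j == i || j == i + 1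

/-- Representatives of the cosets of the automorphism group of the 4-cycle in `Perm (Fin 4)`. -/
def cosetReps : List (Perm (Fin 4)) := [1, swap 0 1, swap 1 2]

theorem exists_cosetRep (π : Perm (Fin 4)) : ∃ σ ∈ cosetReps, ∃ δ : Perm (Fin 4),
    ∀ i j, cycleMatrix (π i) j = cycleMatrix (σ i) (δ j) := by
  revert π
  decide +kernel

/-- `M` is the bipartite adjacency matrix of an 8-cycle, up to the order of rows and columns. -/
abbrev IsCycleMatrix (M : Fin 4 → Fin 4 → Bool) : Prop :=
  ∃ σ ∈ cosetReps, ∃ τ : Perm (Fin 4), ∀ i j, M i j = cycleMatrix (σ i) (τ j)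

/-- The indicator functions of the two-element subsets of `Fin 4`. -/
def twoSubsets : List (Fin 4 → Bool) :=
  [![true, true, false, false], ![true, false, true, false], ![true, false, false, true],
   ![false, true, true, false], ![false, true, false, true], ![false, false, true, true]]

theorem mem_twoSubsets : ∀ a : Fin 4 → Bool, #{j | a j} = 2 → a ∈ twoSubsets := by
  decide +kernel

theorem isCycleMatrix_of_rows : ∀ a ∈ twoSubsets, ∀ b ∈ twoSubsets, a ≠ b →
    ∀ c ∈ twoSubsets, a ≠ c → b ≠ c → ∀ d ∈ twoSubsets, a ≠ d → b ≠ d → c ≠ d →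
    (∀ j, #{i | ![a, b, c, d] i j} = 2) → IsCycleMatrix ![a, b, c, d] := by
  set_option synthInstance.maxHeartbeats 400000 in
  set_option synthInstance.maxSize 4000 in
  decide +kernel

/-- A 2-regular bipartite graph on 4 + 4 vertices without a 4-cycle is an 8-cycle. -/
theorem isCycleMatrix_of_two_regular (M : Fin 4 → Fin 4 → Bool) (hr : ∀ i, #{j | M i j} = 2)
    (hc : ∀ j, #{i | M i j} = 2) (hM : Function.Injective M) : IsCycleMatrix M := by
  have h : M = ![M 0, M 1, M 2, M 3] := by ext i; fin_cases i <;> rfl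
  rw [h]
  exact isCycleMatrix_of_rows _ (mem_twoSubsets _ (hr 0)) _ (mem_twoSubsets _ (hr 1))
    (hM.ne (by decide)) _ (mem_twoSubsets _ (hr 2)) (hM.ne (by decide)) (hM.ne (by decide))
    _ (mem_twoSubsets _ (hr 3)) (hM.ne (by decide)) (hM.ne (by decide)) (hM.ne (by decide))
    fun j ↦ by rw [← h]; exact hc j

/-- The adjacency relation on three complete blocks of four vertices joined by `r`, `s` and `t`:
an entry `k l i j` relates vertex `i` of block `k` to vertex `j` of block `l`. -/
def blockMatrix (r s t : Fin 4 → Fin 4 → Bool) (k l : Fin 3) (i j : Fin 4) : Bool :=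
  ![![i != j, r i j, t i j], ![r j i, i != j, s i j], ![t j i, s j i, i != j]] k l

theorem blockMatrix_symm (r s t : Fin 4 → Fin 4 → Bool) (k l : Fin 3) (i j : Fin 4) :
    blockMatrix r s t k l i j = blockMatrix r s t l k j i := by
  fin_cases k <;> fin_cases l <;> simp [blockMatrix, bne_comm]

theorem blockMatrix_diag (r s t : Fin 4 → Fin 4 → Bool) (k : Fin 3) (i j : Fin 4) :
    blockMatrix r s t k k i j = (i != j) := by
  fin_cases k <;> simp [blockMatrix]

theorem eq_blockMatrix {M : Fin 3 → Fin 3 → Fin 4 → Fin 4 → Bool}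
    (hdiag : ∀ k i j, M k k i j = (i != j)) (hsymm : ∀ k l i j, M k l i j = M l k j i) :
    M = blockMatrix (M 0 1) (M 1 2) (M 0 2) := by
  ext k l i j
  fin_cases k <;> fin_cases l <;> simp [blockMatrix, hdiag, hsymm 1 0, hsymm 2 0, hsymm 2 1]

/-- No two vertices of a block form a 4-clique with one vertex in each of the other blocks. -/
def NoSpreadClique (M : Fin 3 → Fin 3 → Fin 4 → Fin 4 → Bool) : Prop :=
  ∀ k l m : Fin 3, k ≠ l → k ≠ m → l ≠ m → ∀ i i' : Fin 4, i ≠ i' →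
    ∀ j, M k l i j → M k l i' j → ∀ n, M k m i n → M k m i' n → ¬ M l m j n

instance : DecidablePred NoSpreadClique := fun M ↦ by unfold NoSpreadClique; infer_instance

theorem NoSpreadClique.relabel {M : Fin 3 → Fin 3 → Fin 4 → Fin 4 → Bool}
    (h : NoSpreadClique M) (u : Fin 3 → Perm (Fin 4)) :
    NoSpreadClique fun k l i j ↦ M k l (u k i) (u l j) :=
  fun k l m hkl hkm hlm _ _ hi _ hj hj' _ hn hn' ↦
    h k l m hkl hkm hlm _ _ ((u k).injective.ne hi) _ hj hj' _ hn hn'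

/-- The block of a vertex: the vertices `0, …, 11` form three blocks of four. -/
def block (x : Fin 12) : Fin 3 := Fin.divNat (n := 4) x

/-- The position of a vertex in its block. -/
def position (x : Fin 12) : Fin 4 := Fin.modNat (m := 3) x

/-- The graph on `Fin 12` with adjacency relation `blockMatrix`. -/
def blockGraph (r s t : Fin 4 → Fin 4 → Bool) : SimpleGraph (Fin 12) where
  Adj x y := blockMatrix r s t (block x) (block y) (position x) (position y)
  symm := ⟨fun _ _ h ↦ by rwa [blockMatrix_symm]⟩
  loopless := ⟨fun _ ↦ by simp [blockMatrix_diag]⟩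

instance (r s t : Fin 4 → Fin 4 → Bool) : DecidableRel (blockGraph r s t).Adj := fun x y ↦ by
  unfold blockGraph; infer_instance

/-- The vertex-transitive maximal strongly `(3,4)`-clique-partitioned graph. -/
abbrev transitiveGraph : SimpleGraph (Fin 12) :=
  blockGraph cycleMatrix cycleMatrix fun i j ↦ cycleMatrix i (![1, 2, 3, 0] j)

/-- The maximal strongly `(3,4)`-clique-partitioned graph that is not vertex-transitive. -/
abbrev intransitiveGraph : SimpleGraph (Fin 12) :=
  blockGraph cycleMatrix cycleMatrix fun i j ↦ cycleMatrix (![1, 0, 2, 3] i) (![1, 3, 2, 0] j)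

/-- A `blockGraph` in which adjacent vertices of different blocks lie in no common 4-clique is
strongly `(3,4)`-clique-partitioned. -/
theorem stronglyCP_blockGraph {r s t : Fin 4 → Fin 4 → Bool}
    (h : ∀ x y, (blockGraph r s t).Adj x y → block x ≠ block y →
      ∀ z, (blockGraph r s t).Adj x z → (blockGraph r s t).Adj y z →
      ∀ w, (blockGraph r s t).Adj x w → (blockGraph r s t).Adj y w →
        ¬ (blockGraph r s t).Adj z w) : StronglyCP (blockGraph r s t) 3 4 := by
  let B (k : Fin 3) : Finset (Fin 12) := {x | block x = k}
  have hB : ∀ k, #(B k) = 4 := by decide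
  refine StronglyCP.of_isCliquePartition (P := univ.image B) (by simp)
    ⟨by decide, fun u hu ↦ ?_, fun u hu v hv huv ↦ ?_, by decide⟩ fun u hu ↦ ?_
  · obtain ⟨k, -, rfl⟩ := mem_image.1 hu
    refine ⟨fun x hx y hy hxy ↦ ?_, hB k⟩
    have hne : ∀ x y : Fin 12, block x = block y → x ≠ y → position x ≠ position y := by decide
    have hxy' : block x = block y := by simp_all [B]
    simp [blockGraph, hxy', blockMatrix_diag, hne x y hxy' hxy]
  · obtain ⟨k, -, rfl⟩ := mem_image.1 hu
    obtain ⟨l, -, rfl⟩ := mem_image.1 hv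
    exact disjoint_filter.2 fun x _ hk hl ↦ huv (by rw [← hk, hl])
  · obtain ⟨x, hx⟩ : u.Nonempty := card_pos.1 (by simp [hu.card_eq])
    refine mem_image.2 ⟨block x, mem_univ _, Eq.symm <|
      eq_of_subset_of_card_le (fun y hy ↦ mem_filter_univ _ |>.2 ?_) (by simp [hu.card_eq, hB])⟩
    by_contra hne
    have hxy : x ≠ y := fun h ↦ hne (h ▸ rfl)
    obtain ⟨z, w, hzw, huxy⟩ := card_eq_two.1 (show #((u.erase x).erase y) = 2
      by rw [card_erase_of_mem (mem_erase.2 ⟨hxy.symm, hy⟩), card_erase_of_mem hx, hu.card_eq])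
    have hz : z ∈ (u.erase x).erase y := by simp [huxy]
    have hw : w ∈ (u.erase x).erase y := by simp [huxy]
    simp only [mem_erase] at hz hw
    exact h x y (hu.isClique hx hy hxy) (Ne.symm hne)
      z (hu.isClique hx hz.2.2 hz.2.1.symm) (hu.isClique hy hz.2.2 hz.1.symm)
      w (hu.isClique hx hw.2.2 hw.2.1.symm) (hu.isClique hy hw.2.2 hw.1.symm)
      (hu.isClique hz.2.2 hw.2.2 hzw)

theorem stronglyCP_transitiveGraph : StronglyCP transitiveGraph 3 4 :=
  stronglyCP_blockGraph (by decide +kernel)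

theorem stronglyCP_intransitiveGraph : StronglyCP intransitiveGraph 3 4 :=
  stronglyCP_blockGraph (by decide +kernel)

theorem card_edgeSet_transitiveGraph : Nat.card transitiveGraph.edgeSet = 42 := by
  rw [Nat.card_eq_fintype_card, ← edgeFinset_card]
  decide +kernel

theorem card_edgeSet_intransitiveGraph : Nat.card intransitiveGraph.edgeSet = 42 := by
  rw [Nat.card_eq_fintype_card, ← edgeFinset_card]
  decide +kernel

/-- Every vertex of `transitiveGraph` lies in 10 triangles, but some vertex of `intransitiveGraph`
does not. -/
theorem isEmpty_iso : IsEmpty (transitiveGraph ≃g intransitiveGraph) := by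
  refine ⟨fun φ ↦ ?_⟩
  let T (G : SimpleGraph (Fin 12)) [DecidableRel G.Adj] (v : Fin 12) : Finset (Fin 12 × Fin 12) :=
    {p | G.Adj v p.1 ∧ G.Adj v p.2 ∧ G.Adj p.1 p.2}
  have h : ∀ v, #(T transitiveGraph v) = #(T intransitiveGraph (φ v)) := fun v ↦
    card_equiv (φ.toEquiv.prodCongr φ.toEquiv) (by simp [T, φ.map_adj_iff])
  have h₁ : ∀ v, #(T transitiveGraph v) = 20 := by decide +kernel
  have h₂ : ∃ v, #(T intransitiveGraph v) ≠ 20 := by decide +kernel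
  obtain ⟨v, hv⟩ := h₂
  exact hv (by rw [← φ.apply_symm_apply v, ← h, h₁])

/-- Renamings of the vertices that turn the block matrices with entries `cycleMatrix` into
`transitiveGraph` or `intransitiveGraph`. -/
def relabelings : List (Fin 3 → Fin 4 → Fin 12) :=
  [![![0, 1, 2, 3], ![4, 5, 6, 7], ![8, 9, 10, 11]],
   ![![0, 1, 2, 3], ![11, 8, 9, 10], ![6, 7, 4, 5]],
   ![![0, 3, 2, 1], ![5, 4, 7, 6], ![10, 9, 8, 11]],
   ![![1, 0, 3, 2], ![6, 5, 4, 7], ![11, 10, 9, 8]],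
   ![![1, 2, 3, 0], ![5, 6, 7, 4], ![9, 10, 11, 8]],
   ![![5, 4, 7, 6], ![1, 0, 3, 2], ![10, 8, 11, 9]],
   ![![5, 4, 7, 6], ![10, 9, 8, 11], ![3, 2, 0, 1]],
   ![![1, 0, 2, 3], ![11, 8, 10, 9], ![4, 7, 6, 5]],
   ![![1, 3, 2, 0], ![8, 11, 9, 10], ![6, 7, 4, 5]],
   ![![4, 5, 6, 7], ![3, 0, 1, 2], ![9, 11, 8, 10]],
   ![![4, 5, 6, 7], ![8, 9, 10, 11], ![1, 0, 2, 3]],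
   ![![0, 1, 3, 2], ![10, 8, 11, 9], ![5, 6, 7, 4]],
   ![![0, 2, 3, 1], ![8, 10, 9, 11], ![7, 4, 5, 6]]]

theorem relabelings_injective :
    ∀ p ∈ relabelings, ∀ k i l j, p k i = p l j → k = l ∧ i = j := by
  simp only [relabelings, List.forall_mem_cons]
  refine ⟨?_, ?_, ?_, ?_, ?_, ?_, ?_, ?_, ?_, ?_, ?_, ?_, ?_, by simp⟩
  all_goals decide +kernel

theorem exists_relabeling : ∀ σ ∈ cosetReps, ∀ α ∈ cosetReps, ∀ γ : Perm (Fin 4),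
    NoSpreadClique (blockMatrix cycleMatrix (fun i ↦ cycleMatrix (σ i))
      fun i j ↦ cycleMatrix (α i) (γ j)) →
    ∃ p ∈ relabelings,
      (∀ k l i j, blockMatrix cycleMatrix (fun i ↦ cycleMatrix (σ i))
        (fun i j ↦ cycleMatrix (α i) (γ j)) k l i j ↔ transitiveGraph.Adj (p k i) (p l j)) ∨
      (∀ k l i j, blockMatrix cycleMatrix (fun i ↦ cycleMatrix (σ i))
        (fun i j ↦ cycleMatrix (α i) (γ j)) k l i j ↔ intransitiveGraph.Adj (p k i) (p l j)) := by
  decide +kernel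

/-- A strongly `(3,4)`-clique-partitioned graph consists of three blocks of four vertices, and
every 4-clique lies in a block. -/
theorem StronglyCP.exists_blocks {V : Type} [Fintype V] [DecidableEq V] {G : SimpleGraph V}
    (h : StronglyCP G 3 4) : ∃ e : Fin 3 × Fin 4 ≃ V,
      (∀ k i j, G.Adj (e (k, i)) (e (k, j)) ↔ i ≠ j) ∧
      ∀ x y z w, G.Adj (e x) (e y) → G.Adj (e x) (e z) → G.Adj (e x) (e w) →
        G.Adj (e y) (e z) → G.Adj (e y) (e w) → G.Adj (e z) (e w) → x.1 = w.1 := by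
  obtain ⟨⟨hV, P, hP, -⟩, hs⟩ := h
  obtain ⟨hcard, hclique, hdisj, -⟩ := id hP
  let c : Fin 3 ≃ P := (P.equivFinOfCardEq hcard).symm
  let d (k : Fin 3) : Fin 4 ≃ (c k).1 := ((c k).1.equivFinOfCardEq (hclique _ (c k).2).card_eq).symm
  let f (x : Fin 3 × Fin 4) : V := d x.1 x.2
  have hblock {s : Finset V} (hs : s ∈ P) {x : Fin 3 × Fin 4} (hx : f x ∈ s) : (c x.1).1 = s := by
    by_contra hne
    exact disjoint_left.1 (hdisj _ (c x.1).2 _ hs hne) (d x.1 x.2).2 hx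
  have hinj : Function.Injective f := by
    rintro ⟨k, i⟩ ⟨l, j⟩ hxy
    obtain rfl : k = l := c.injective (Subtype.ext (hblock (c l).2 (by rw [hxy]; exact (d l j).2)))
    exact congrArg _ ((d k).injective (Subtype.ext hxy))
  have hbij : Function.Bijective f :=
    (Fintype.bijective_iff_injective_and_card f).2 ⟨hinj, by simp [hV]⟩
  refine ⟨Equiv.ofBijective f hbij, fun k i j ↦ ⟨fun h hij ↦ ?_, fun hij ↦ ?_⟩,
    fun x y z w hxy hxz hxw hyz hyw hzw ↦ ?_⟩
  · exact G.irrefl (hij ▸ h)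
  · exact (hclique _ (c k).2).isClique (d k i).2 (d k j).2
      (Subtype.coe_injective.ne ((d k).injective.ne hij))
  · have hclq : G.IsNClique 4 {f x, f y, f z, f w} :=
      (is3Clique_triple_iff.2 ⟨hyz, hyw, hzw⟩).insert (by simpa using ⟨hxy, hxz, hxw⟩)
    have hmem := hs P hP _ hclq
    exact c.injective (Subtype.ext
      ((hblock hmem (x := x) (by simp)).trans (hblock hmem (x := w) (by simp)).symm))

/-- In a maximal strongly `(3,4)`-clique-partitioned graph every vertex has exactly two
neighbours in each of the blocks that do not contain it. -/
theorem card_row_eq_two {V : Type} [Fintype V] [DecidableEq V] {G : SimpleGraph V}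
    [DecidableRel G.Adj] (hcard : #G.edgeFinset = 42) {e : Fin 3 × Fin 4 ≃ V}
    (hadj : ∀ k i j, G.Adj (e (k, i)) (e (k, j)) ↔ i ≠ j)
    (hclique : ∀ x y z w, G.Adj (e x) (e y) → G.Adj (e x) (e z) → G.Adj (e x) (e w) →
        G.Adj (e y) (e z) → G.Adj (e y) (e w) → G.Adj (e z) (e w) → x.1 = w.1)
    {k l : Fin 3} (hkl : k ≠ l) (i : Fin 4) : #{j | G.Adj (e (k, i)) (e (l, j))} = 2 := by
  let r (x : (Fin 3 × Fin 4) × Fin 3) : ℕ := #{j | G.Adj (e x.1) (e (x.2, j))}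
  let b (x : (Fin 3 × Fin 4) × Fin 3) : ℕ := if x.1.1 = x.2 then 3 else 2
  have hle : ∀ x ∈ univ, r x ≤ b x := by
    rintro ⟨⟨k, i⟩, l⟩ -
    by_cases h : k = l
    · subst h
      simp [r, b, hadj, filter_ne, card_erase_of_mem]
    · simp only [r, b, h, if_false]
      by_contra! hlt
      obtain ⟨j₁, j₂, j₃, h₁, h₂, h₃, h₁₂, h₁₃, h₂₃⟩ := two_lt_card_iff.1 hlt
      simp only [mem_filter_univ] at h₁ h₂ h₃
      exact h (hclique _ _ _ _ h₁ h₂ h₃ ((hadj ..).2 h₁₂) ((hadj ..).2 h₁₃) ((hadj ..).2 h₂₃))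
  have hsum : ∑ x, r x = ∑ x, b x := by
    have hdeg : ∀ x, G.degree (e x) = ∑ l, r (x, l) := fun x ↦ by
      simp only [r, card_filter, ← card_neighborFinset_eq_degree, neighborFinset_eq_filter]
      rw [← e.sum_comp, Fintype.sum_prod_type]
    have hb : ∑ x, b x = 84 := by decide +kernel
    rw [hb, Fintype.sum_prod_type, ← sum_congr rfl fun x _ ↦ hdeg x,
      e.sum_comp fun v ↦ G.degree v, sum_degrees_eq_twice_card_edges, hcard]
  simpa [r, b, hkl] using (sum_eq_sum_iff_of_le hle).1 hsum ((k, i), l) (mem_univ _)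

/-- Relabeling the blocks turns three joined 8-cycles into one of the two graphs. -/
theorem exists_equiv_of_isCycleMatrix {M : Fin 3 → Fin 3 → Fin 4 → Fin 4 → Bool}
    (hdiag : ∀ k i j, M k k i j = (i != j)) (hsymm : ∀ k l i j, M k l i j = M l k j i)
    (hM : NoSpreadClique M) (hcycle : ∀ k l, k ≠ l → IsCycleMatrix (M k l)) :
    ∃ p : Fin 3 × Fin 4 ≃ Fin 12,
      (∀ x y, transitiveGraph.Adj (p x) (p y) ↔ M x.1 y.1 x.2 y.2) ∨
      (∀ x y, intransitiveGraph.Adj (p x) (p y) ↔ M x.1 y.1 x.2 y.2) := by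
  obtain ⟨a, -, b, hr⟩ := hcycle 0 1 (by decide)
  obtain ⟨c, -, d, hs⟩ := hcycle 1 2 (by decide)
  obtain ⟨f, -, g, ht⟩ := hcycle 0 2 (by decide)
  obtain ⟨σ, hσ, δ, hδ⟩ := exists_cosetRep (c * b⁻¹)
  obtain ⟨α, hα, ε, hε⟩ := exists_cosetRep (f * a⁻¹)
  let u : Fin 3 → Perm (Fin 4) := ![a⁻¹, b⁻¹, (δ * d)⁻¹]
  have hu : (fun k l i j ↦ M k l (u k i) (u l j)) = blockMatrix cycleMatrix
      (fun i ↦ cycleMatrix (σ i)) fun i j ↦ cycleMatrix (α i) ((ε * g * (δ * d)⁻¹) j) := by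
    rw [eq_blockMatrix (M := fun k l i j ↦ M k l (u k i) (u l j))
      (fun k i j ↦ by simp [hdiag, bne, beq_eq_decide]) fun k l i j ↦ hsymm ..]
    congr 1 <;> ext i j
    · simp [u, hr]
    · simpa [u, hs] using hδ i (d (d⁻¹ (δ⁻¹ j)))
    · simpa [u, ht] using hε i (g (d⁻¹ (δ⁻¹ j)))
  obtain ⟨p, hp, h⟩ := exists_relabeling σ hσ α hα _ (hu ▸ hM.relabel u)
  have hbij : Function.Bijective fun x : Fin 3 × Fin 4 ↦ p x.1 x.2 :=
    (Fintype.bijective_iff_injective_and_card _).2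
      ⟨fun _ _ h ↦ Prod.ext_iff.2 (relabelings_injective p hp _ _ _ _ h), by simp⟩
  let v : Fin 3 × Fin 4 ≃ Fin 3 × Fin 4 := Equiv.prodCongrRight u
  refine ⟨v.symm.trans (Equiv.ofBijective _ hbij), h.imp (fun h x y ↦ ?_) fun h x y ↦ ?_⟩ <;>
  · obtain ⟨x, rfl⟩ := v.surjective x
    obtain ⟨y, rfl⟩ := v.surjective y
    rw [← hu] at h
    simpa [v] using (h x.1 y.1 x.2 y.2).symm

/-- Up to isomorphism there are precisely two strongly
`(3,4)`-clique-partitioned graphs with the maximum number `42` of edges. -/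
theorem strongly_cp_34_two_classes :
    ∃ G₁ G₂ : SimpleGraph (Fin 12),
      StronglyCP G₁ 3 4 ∧ Nat.card G₁.edgeSet = 42 ∧
      StronglyCP G₂ 3 4 ∧ Nat.card G₂.edgeSet = 42 ∧
      IsEmpty (G₁ ≃g G₂) ∧
      ∀ {V : Type} [Fintype V] [DecidableEq V] (G : SimpleGraph V),
        StronglyCP G 3 4 → Nat.card G.edgeSet = 42 →
        (Nonempty (G ≃g G₁) ∨ Nonempty (G ≃g G₂)) := by
  refine ⟨transitiveGraph, intransitiveGraph, stronglyCP_transitiveGraph,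
    card_edgeSet_transitiveGraph, stronglyCP_intransitiveGraph, card_edgeSet_intransitiveGraph,
    isEmpty_iso, fun {V} _ _ G hG hcard ↦ ?_⟩
  classical
  rw [Nat.card_eq_fintype_card, ← edgeFinset_card] at hcard
  obtain ⟨e, hadj, hclique⟩ := hG.exists_blocks
  have hrow {k l : Fin 3} (hkl : k ≠ l) (i : Fin 4) := card_row_eq_two hcard hadj hclique hkl i
  obtain ⟨p, hp⟩ := exists_equiv_of_isCycleMatrix
    (M := fun k l i j ↦ decide (G.Adj (e (k, i)) (e (l, j))))
    (fun k i j ↦ by simp [hadj, bne, beq_eq_decide]) (fun k l i j ↦ by simp [G.adj_comm])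
    (fun k l m hkl hkm hlm i i' hi j hj hj' n hn hn' hjn ↦ by
      simp only [decide_eq_true_eq] at *
      exact hkm (hclique _ _ _ _ ((hadj ..).2 hi) hj hn hj' hn' hjn))
    fun k l hkl ↦ isCycleMatrix_of_two_regular _ (fun i ↦ by simpa using hrow hkl i)
      (fun j ↦ by simpa [G.adj_comm] using hrow hkl.symm j) fun i i' h ↦ by
        by_contra hi
        obtain ⟨j, j', hj, hrow⟩ := card_eq_two.1 (hrow hkl i)
        have hmem : ∀ n ∈ ({j, j'} : Finset (Fin 4)),
            G.Adj (e (k, i)) (e (l, n)) ∧ G.Adj (e (k, i')) (e (l, n)) := fun n hn ↦ by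
          have hn' : G.Adj (e (k, i)) (e (l, n)) := by simpa [← hrow] using hn
          exact ⟨hn', by simpa [hn'] using (congrFun h n).symm⟩
        obtain ⟨h₁, h₂⟩ := hmem j (by simp)
        obtain ⟨h₃, h₄⟩ := hmem j' (by simp)
        exact hkl (hclique _ _ _ _ ((hadj ..).2 hi) h₁ h₃ h₂ h₄ ((hadj ..).2 hj))
  refine hp.imp (fun h ↦ ⟨⟨e.symm.trans p, fun {x y} ↦ ?_⟩⟩) fun h ↦
    ⟨⟨e.symm.trans p, fun {x y} ↦ ?_⟩⟩ <;>
  simp [h]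
end

section
/- Let n ≥ 2 and v ≥ 2, and let G be a weakly (n,v)-clique-partitioned simple graph. Then the number of edges of G is at most C(nv,2) - n·(n-1)·v/2, where C(nv,2) = nv(nv-1)/2. -/
open SimpleGraph Finset

/-- Distinct parts of a clique partition are disjoint, so a part is determined by any element. -/
lemma IsCliquePartition.eq_of_mem {V : Type} [Fintype V] [DecidableEq V] {G : SimpleGraph V}
    {n v : ℕ} {P : Finset (Finset V)} (h : IsCliquePartition G n v P) {s t : Finset V}
    (hs : s ∈ P) (ht : t ∈ P) {x : V} (hxs : x ∈ s) (hxt : x ∈ t) : s = t := by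
  by_contra hst
  exact Finset.disjoint_left.mp (h.2.2.1 s hs t ht hst) hxs hxt

/-- Exchanging `a` and `b` between two parts of a clique partition gives a clique partition,
provided each of them is adjacent to the rest of the other's part. -/
lemma IsCliquePartition.image_swap {V : Type} [Fintype V] [DecidableEq V] {G : SimpleGraph V}
    {n v : ℕ} {P : Finset (Finset V)} (h : IsCliquePartition G n v P) {s t : Finset V}
    (hs : s ∈ P) (ht : t ∈ P) (hst : s ≠ t) {a b : V} (ha : a ∈ s) (hb : b ∈ t)
    (hat : ∀ y ∈ t, y ≠ b → G.Adj a y) (hbs : ∀ x ∈ s, x ≠ a → G.Adj x b) :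
    IsCliquePartition G n v (P.image fun u => u.map (Equiv.swap a b).toEmbedding) := by
  have hmem : ∀ {u w : Finset V}, u ∈ P → w ∈ P → ∀ {x : V}, x ∈ u → x ∈ w → u = w :=
    fun hu hw _ hxu hxw => h.eq_of_mem hu hw hxu hxw
  obtain ⟨hcard, hclique, hdisj, hunion⟩ := h
  refine ⟨?_, ?_, ?_, ?_⟩
  · rw [Finset.card_image_of_injective _ (Finset.map_injective _), hcard]
  · simp only [Finset.mem_image, forall_exists_index, and_imp, forall_apply_eq_imp_iff₂]
    intro u hu
    refine ⟨?_, by rw [Finset.card_map, (hclique u hu).card_eq]⟩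
    have hadj : ∀ x ∈ u, ∀ y ∈ u, x ≠ y → G.Adj x y := fun x hx y hy hxy =>
      (hclique u hu).isClique hx hy hxy
    have hau : a ∈ u → u = s := fun hx => hmem hu hs hx ha
    have hbu : b ∈ u → u = t := fun hx => hmem hu ht hx hb
    intro x' hx' y' hy' hxy'
    simp only [Finset.coe_map, Set.mem_image, Finset.mem_coe, Equiv.coe_toEmbedding] at hx' hy'
    obtain ⟨x, hx, rfl⟩ := hx'
    obtain ⟨y, hy, rfl⟩ := hy'
    have hxy : x ≠ y := fun e => hxy' (by rw [e])
    simp only [Equiv.swap_apply_def]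
    grind [SimpleGraph.Adj.symm]
  · simp only [Finset.mem_image, forall_exists_index, and_imp, forall_apply_eq_imp_iff₂]
    intro u hu w hw huw
    rw [Finset.disjoint_map]
    exact hdisj u hu w hw fun e => huw (by rw [e])
  · ext x
    have hx : Equiv.swap a b x ∈ P.biUnion id := hunion ▸ Finset.mem_univ _
    simp only [Finset.mem_biUnion, id] at hx
    obtain ⟨u, hu, hxu⟩ := hx
    simp only [Finset.mem_biUnion, Finset.mem_image, id, Finset.mem_univ, iff_true]
    exact ⟨_, ⟨u, hu, rfl⟩, Finset.mem_map.mpr ⟨_, hxu, by simp⟩⟩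

/-- Two distinct parts of a unique clique partition span at least `v` non-adjacent pairs. -/
lemma IsCliquePartition.le_card_interedges_compl {V : Type} [Fintype V] [DecidableEq V]
    {G : SimpleGraph V} [DecidableRel G.Adj] {n v : ℕ} (hv : 2 ≤ v) {P : Finset (Finset V)}
    (h : IsCliquePartition G n v P) (huniq : ∀ Q, IsCliquePartition G n v Q → Q = P)
    {s t : Finset V} (hs : s ∈ P) (ht : t ∈ P) (hst : s ≠ t) :
    v ≤ (Gᶜ.interedges s t).card := by
  have hne : ∀ x ∈ s, ∀ y ∈ t, x ≠ y := fun x hx y hy e => hst (h.eq_of_mem hs ht hx (e ▸ hy))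
  by_cases hA : ∀ x ∈ s, ∃ y ∈ t, ¬ G.Adj x y
  · calc v = s.card := (h.2.1 s hs).card_eq.symm
      _ ≤ ((Gᶜ.interedges s t).image Prod.fst).card := by
        refine Finset.card_le_card fun x hx => ?_
        obtain ⟨y, hy, hxy⟩ := hA x hx
        exact Finset.mem_image.mpr ⟨(x, y), by
          simp [SimpleGraph.mem_interedges_iff, hx, hy, hxy, hne x hx y hy], rfl⟩
      _ ≤ _ := Finset.card_image_le
  by_cases hB : ∀ y ∈ t, ∃ x ∈ s, ¬ G.Adj x y
  · calc v = t.card := (h.2.1 t ht).card_eq.symm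
      _ ≤ ((Gᶜ.interedges s t).image Prod.snd).card := by
        refine Finset.card_le_card fun y hy => ?_
        obtain ⟨x, hx, hxy⟩ := hB y hy
        exact Finset.mem_image.mpr ⟨(x, y), by
          simp [SimpleGraph.mem_interedges_iff, hx, hy, hxy, hne x hx y hy], rfl⟩
      _ ≤ _ := Finset.card_image_le
  push Not at hA hB
  obtain ⟨a, ha, hat⟩ := hA
  obtain ⟨b, hb, hbs⟩ := hB
  have hQ := huniq _ (h.image_swap hs ht hst ha hb (fun y hy _ => hat y hy) fun x hx _ => hbs x hx)
  have hsP : s.map (Equiv.swap a b).toEmbedding ∈ P := hQ ▸ Finset.mem_image_of_mem _ hs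
  have hst' : s.map (Equiv.swap a b).toEmbedding = t :=
    h.eq_of_mem hsP ht (Finset.mem_map.mpr ⟨a, ha, by simp⟩) hb
  obtain ⟨c, hc, hca⟩ := Finset.exists_mem_ne (by rw [(h.2.1 s hs).card_eq]; omega) a
  refine (hne c hc c ?_ rfl).elim
  rw [← hst']
  exact Finset.mem_map.mpr ⟨c, hc, Equiv.swap_apply_of_ne_of_ne hca (hne c hc b hb)⟩

/-- A graph and its complement together have as many edges as the complete graph. -/
lemma card_edgeFinset_add_card_edgeFinset_compl {V : Type} [Fintype V] [DecidableEq V]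
    (G : SimpleGraph V) [DecidableRel G.Adj] :
    G.edgeFinset.card + Gᶜ.edgeFinset.card = (Fintype.card V).choose 2 := by
  rw [← SimpleGraph.card_edgeFinset_top_eq_card_choose_two (V := V), ← Finset.card_union_of_disjoint
    (SimpleGraph.disjoint_edgeFinset.mpr disjoint_compl_right), ← SimpleGraph.edgeFinset_sup]
  congr!
  exact sup_compl_eq_top

/-- If `G` is a weakly `(n,v)`-clique-partitioned graph (`n,v ≥ 2`),
then `G` has at most `C(nv,2) - n·(n-1)·v/2` edges. -/
theorem weakly_cp_edge_bound {V : Type} [Fintype V] [DecidableEq V]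
    (n v : ℕ) (hn : 2 ≤ n) (hv : 2 ≤ v) (G : SimpleGraph V)
    (hG : WeaklyCP G n v) :
    Nat.card G.edgeSet ≤ (n * v).choose 2 - n * (n - 1) * v / 2 := by
  classical
  obtain ⟨hV, P, hP, huniq⟩ := hG
  have hcompl : n * (n - 1) * v ≤ 2 * Gᶜ.edgeFinset.card := by
    calc n * (n - 1) * v = P.offDiag.card * v := by
          rw [Finset.offDiag_card, hP.1, Nat.mul_sub_one]
      _ ≤ ∑ p ∈ P.offDiag, (Gᶜ.interedges p.1 p.2).card := by
          rw [← smul_eq_mul]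
          refine Finset.card_nsmul_le_sum _ _ _ fun p hp => ?_
          obtain ⟨hs, ht, hst⟩ := Finset.mem_offDiag.mp hp
          exact hP.le_card_interedges_compl hv huniq hs ht hst
      _ = (P.offDiag.biUnion fun p => Gᶜ.interedges p.1 p.2).card := by
          refine (Finset.card_biUnion fun p hp q hq hpq => ?_).symm
          obtain ⟨hs, ht, -⟩ := Finset.mem_offDiag.mp hp
          obtain ⟨hs', ht', -⟩ := Finset.mem_offDiag.mp hq
          refine Finset.disjoint_left.mpr fun x hx hy => hpq ?_
          rw [SimpleGraph.mem_interedges_iff] at hx hy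
          exact Prod.ext (hP.eq_of_mem hs hs' hx.1 hy.1) (hP.eq_of_mem ht ht' hx.2.1 hy.2.1)
      _ ≤ (Finset.univ.filter fun p : V × V => Gᶜ.Adj p.1 p.2).card := by
          refine Finset.card_le_card fun x hx => ?_
          obtain ⟨p, -, hx⟩ := Finset.mem_biUnion.mp hx
          rw [SimpleGraph.mem_interedges_iff] at hx
          exact Finset.mem_filter.mpr ⟨Finset.mem_univ _, hx.2.2⟩
      _ = 2 * Gᶜ.edgeFinset.card := by
          rw [← SimpleGraph.sum_degrees_eq_twice_card_edges, Finset.card_filter,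
            Fintype.sum_prod_type]
          refine Finset.sum_congr rfl fun x _ => ?_
          rw [← Finset.card_filter, ← SimpleGraph.card_neighborFinset_eq_degree,
            SimpleGraph.neighborFinset_eq_filter]
  have hsum := card_edgeFinset_add_card_edgeFinset_compl G
  rw [hV] at hsum
  rw [Nat.card_eq_fintype_card, ← SimpleGraph.edgeFinset_card]
  omega
end

section
/- Let n ≥ 3 and v ≥ 2, let G be a maximal weakly (n,v)-clique-partitioned graph, and let X, Y, Z be three distinct cliques in the unique v-clique decomposition of G. If x ∈ X has no neighbour in Y and x' ∈ X has no neighbour in Z, then x = x'; that is, the distinguished non-adjacent vertex of a clique is the same towards every other clique. -/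
open SimpleGraph Finset

section Auxiliary

variable {V : Type} {G : SimpleGraph V} {n v : ℕ} {P : Finset (Finset V)} {A B S T : Finset V}

/-- The number of non-adjacent pairs between two vertex sets. -/
def nonadjCount (G : SimpleGraph V) [DecidableRel G.Adj] (A B : Finset V) : ℕ :=
  ∑ a ∈ A, (B.filter fun b => ¬ G.Adj a b).card

lemma nonadjCount_comm [DecidableRel G.Adj] (A B : Finset V) :
    nonadjCount G A B = nonadjCount G B A := by
  unfold nonadjCount
  have := sum_card_bipartiteAbove_eq_sum_card_bipartiteBelow (s := A) (t := B)
    (fun a b => ¬ G.Adj a b)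
  simp only [bipartiteAbove, bipartiteBelow] at this
  simpa only [G.adj_comm] using this

variable [DecidableEq V]

/-- If all the non-adjacent pairs are accounted for by one vertex, the others are joined to `B`. -/
lemma adj_of_nonadjCount_eq [DecidableRel G.Adj] (hm : nonadjCount G A B = B.card) {a : V}
    (ha : a ∈ A) (h : ∀ b ∈ B, ¬ G.Adj a b) : ∀ c ∈ A \ {a}, ∀ b ∈ B, G.Adj c b := by
  intro c hc b hb
  by_contra hcb
  obtain ⟨hcA, hca⟩ := mem_sdiff.1 hc
  have h1 := sum_erase_add A (fun a => (B.filter fun b => ¬ G.Adj a b).card) ha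
  have h2 : (B.filter fun b => ¬ G.Adj a b).card = B.card := by rw [filter_true_of_mem h]
  have h3 := single_le_sum (f := fun a => (B.filter fun b => ¬ G.Adj a b).card)
    (fun _ _ => Nat.zero_le _) (mem_erase.2 ⟨fun h => hca (mem_singleton.2 h), hcA⟩)
  have h4 : 0 < (B.filter fun b => ¬ G.Adj c b).card :=
    card_pos.2 ⟨b, mem_filter.2 ⟨hb, hcb⟩⟩
  unfold nonadjCount at hm
  omega

/-- Exchanging part of a clique for an equally large, completely joined part of another clique. -/
lemma isNClique_sdiff_union (hA : G.IsNClique v A) (hB : G.IsNClique v B)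
    (hAB : Disjoint A B) (hS : S ⊆ A) (hT : T ⊆ B) (hST : S.card = T.card)
    (hadj : ∀ a ∈ A \ S, ∀ b ∈ T, G.Adj a b) : G.IsNClique v (A \ S ∪ T) := by
  refine ⟨?_, ?_⟩
  · intro a ha b hb hab
    simp only [coe_union, Set.mem_union, mem_coe] at ha hb
    rcases ha with ha | ha <;> rcases hb with hb | hb
    · exact hA.isClique (mem_sdiff.1 ha).1 (mem_sdiff.1 hb).1 hab
    · exact hadj a ha b hb
    · exact (hadj b hb a ha).symm
    · exact hB.isClique (hT ha) (hT hb) hab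
  · have hd : Disjoint (A \ S) T := hAB.mono sdiff_subset hT
    have := card_le_card hS
    rw [card_union_of_disjoint hd, card_sdiff_of_subset hS, ← hST, hA.card_eq]
    rw [hA.card_eq] at this
    omega

variable [Fintype V]

/-- If the clique partition is unique, replacing some of its cliques by as many disjoint cliques
on the same vertices produces no new clique. -/
lemma replacement_subset (hG : WeaklyCP G n v) (hP : IsCliquePartition G n v P) (hv : 0 < v)
    {Q Q' : Finset (Finset V)} (hQ : Q ⊆ P) (hcard : Q'.card = Q.card)
    (hcl : ∀ s ∈ Q', G.IsNClique v s)
    (hdisj : ∀ s ∈ Q', ∀ t ∈ Q', s ≠ t → Disjoint s t)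
    (hsub : ∀ s ∈ Q', s ⊆ Q.biUnion id) : Q' ⊆ P := by
  obtain ⟨hPn, hPc, hPd, hPu⟩ := hP
  have hcross : ∀ s ∈ P \ Q, ∀ t ∈ Q', Disjoint s t := by
    intro s hs t ht
    refine Disjoint.mono_right (hsub t ht) ?_
    rw [disjoint_biUnion_right]
    intro q hq
    refine hPd s (mem_sdiff.1 hs).1 q (hQ hq) ?_
    rintro rfl
    exact (mem_sdiff.1 hs).2 hq
  have hnew : Disjoint (P \ Q) Q' := by
    rw [Finset.disjoint_left]
    intro s hs hs'
    have h0 := hcross s hs s hs'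
    rw [disjoint_self_iff_empty] at h0
    have := (hcl s hs').card_eq
    rw [h0, card_empty] at this
    omega
  have hcard' : (P \ Q ∪ Q').card = n := by
    have := card_le_card hQ
    rw [card_union_of_disjoint hnew, card_sdiff_of_subset hQ, hcard]
    omega
  have hcl' : ∀ s ∈ P \ Q ∪ Q', G.IsNClique v s := by
    intro s hs
    rcases mem_union.1 hs with hs | hs
    · exact hPc s (mem_sdiff.1 hs).1
    · exact hcl s hs
  have hdisj' : ∀ s ∈ P \ Q ∪ Q', ∀ t ∈ P \ Q ∪ Q', s ≠ t → Disjoint s t := by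
    intro s hs t ht hst
    rcases mem_union.1 hs with hs | hs <;> rcases mem_union.1 ht with ht | ht
    · exact hPd s (mem_sdiff.1 hs).1 t (mem_sdiff.1 ht).1 hst
    · exact hcross s hs t ht
    · exact (hcross t ht s hs).symm
    · exact hdisj s hs t ht hst
  have hpart : IsCliquePartition G n v (P \ Q ∪ Q') := by
    refine ⟨hcard', hcl', hdisj', ?_⟩
    rw [← card_eq_iff_eq_univ, hG.1, card_biUnion (t := id) hdisj', ← hcard']
    exact sum_const_nat fun s hs => (hcl' s hs).card_eq
  rw [← hG.2.unique hpart ⟨hPn, hPc, hPd, hPu⟩]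
  exact subset_union_right

/-- A unique clique partition admits no proper exchange between two of its cliques. -/
lemma not_exchangeable (hG : WeaklyCP G n v) (hP : IsCliquePartition G n v P)
    (hA : A ∈ P) (hB : B ∈ P) (hAB : A ≠ B) (hS : S ⊆ A) (hT : T ⊆ B)
    (hST : S.card = T.card) (hS0 : 0 < S.card) (hSv : S.card < v)
    (h1 : ∀ a ∈ A \ S, ∀ b ∈ T, G.Adj a b) (h2 : ∀ b ∈ B \ T, ∀ a ∈ S, G.Adj b a) : False := by
  have hd := hP.2.2.1 A hA B hB hAB
  have hAc := hP.2.1 A hA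
  have hBc := hP.2.1 B hB
  obtain ⟨t, ht⟩ := card_pos.1 (hST ▸ hS0)
  obtain ⟨a, haA, haS⟩ := exists_mem_notMem_of_card_lt_card (hAc.card_eq.symm ▸ hSv)
  have hd' : Disjoint (A \ S ∪ T) (B \ T ∪ S) := by
    rw [Finset.disjoint_left] at hd ⊢
    intro u
    have := @hS u
    have := @hT u
    have := @hd u
    simp only [mem_union, mem_sdiff]
    tauto
  have hne : A \ S ∪ T ≠ B \ T ∪ S := by
    intro h
    have hm : t ∈ A \ S ∪ T := mem_union_right _ ht
    exact Finset.disjoint_left.1 hd' hm (h ▸ hm)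
  have hsub : ({A \ S ∪ T, B \ T ∪ S} : Finset (Finset V)) ⊆ P := by
    refine replacement_subset hG hP (by omega) (Q := {A, B}) ?_ ?_ ?_ ?_ ?_
    · simp [insert_subset_iff, hA, hB]
    · rw [card_pair hne, card_pair hAB]
    · simp only [mem_insert, mem_singleton, forall_eq_or_imp, forall_eq]
      exact ⟨isNClique_sdiff_union hAc hBc hd hS hT hST h1,
        isNClique_sdiff_union hBc hAc hd.symm hT hS hST.symm h2⟩
    · simp only [mem_insert, mem_singleton, forall_eq_or_imp, forall_eq]
      exact ⟨⟨fun h => absurd rfl h, fun _ => hd'⟩, fun _ => hd'.symm, fun h => absurd rfl h⟩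
    · simp only [mem_insert, mem_singleton, forall_eq_or_imp, forall_eq, biUnion_insert,
        singleton_biUnion, id]
      exact ⟨union_subset_union sdiff_subset hT,
        union_subset (sdiff_subset.trans subset_union_right) (hS.trans subset_union_left)⟩
  have hmem : A \ S ∪ T ∈ P := hsub (mem_insert_self _ _)
  have heq : A \ S ∪ T = A := by
    by_contra h
    exact Finset.disjoint_left.1 (hP.2.2.1 _ hmem _ hA h)
      (mem_union_left _ (mem_sdiff.2 ⟨haA, haS⟩)) haA
  exact Finset.disjoint_left.1 hd (heq ▸ mem_union_right _ ht) (hT ht)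

/-- The cyclic exchange `X → Z → Y → X` of single vertices contradicts uniqueness. -/
lemma not_cyclically_exchangeable (hG : WeaklyCP G n v) (hP : IsCliquePartition G n v P)
    (hv : 2 ≤ v) {X Y Z : Finset V} (hX : X ∈ P) (hY : Y ∈ P) (hZ : Z ∈ P)
    (hXY : X ≠ Y) (hXZ : X ≠ Z) (hYZ : Y ≠ Z) {x y z : V} (hx : x ∈ X) (hy : y ∈ Y) (hz : z ∈ Z)
    (h1 : ∀ a ∈ X \ {x}, G.Adj a y) (h2 : ∀ a ∈ Y \ {y}, G.Adj a z)
    (h3 : ∀ a ∈ Z \ {z}, G.Adj a x) : False := by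
  have dXY := hP.2.2.1 X hX Y hY hXY
  have dXZ := hP.2.2.1 X hX Z hZ hXZ
  have dYZ := hP.2.2.1 Y hY Z hZ hYZ
  have cX := hP.2.1 X hX
  have cY := hP.2.1 Y hY
  have cZ := hP.2.1 Z hZ
  obtain ⟨a, haX, hax⟩ : ∃ a ∈ X, a ∉ ({x} : Finset V) :=
    exists_mem_notMem_of_card_lt_card (by rw [cX.card_eq, card_singleton]; omega)
  have key : ∀ {A B C : Finset V} {a b c : V}, Disjoint A B → Disjoint A C → Disjoint B C →
      a ∈ A → b ∈ B → c ∈ C → Disjoint (A \ {a} ∪ {b}) (B \ {b} ∪ {c}) := by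
    intro A B C a b c hAB hAC hBC ha hb hc
    rw [Finset.disjoint_left] at hAB hAC hBC ⊢
    intro u hu hu'
    simp only [mem_union, mem_sdiff, mem_singleton] at hu hu'
    rcases hu with ⟨hu, -⟩ | rfl <;> rcases hu' with ⟨hu', hu''⟩ | rfl
    · exact hAB hu hu'
    · exact hAC hu hc
    · exact hu'' rfl
    · exact hBC hb hc
  have d1 := key dXY dXZ dYZ hx hy hz
  have d2 := key dYZ dXY.symm dXZ.symm hy hz hx
  have d3 := key dXZ.symm dYZ.symm dXY hz hx hy
  have ne_of_disj : ∀ {A B : Finset V} {b : V}, Disjoint (A ∪ {b}) B → A ∪ {b} ≠ B := by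
    intro A B b hd h
    have hb : b ∈ A ∪ {b} := mem_union_right _ (mem_singleton_self b)
    exact Finset.disjoint_left.1 hd hb (h ▸ hb)
  have hsub : ({X \ {x} ∪ {y}, Y \ {y} ∪ {z}, Z \ {z} ∪ {x}} : Finset (Finset V)) ⊆ P := by
    refine replacement_subset hG hP (by omega) (Q := {X, Y, Z}) ?_ ?_ ?_ ?_ ?_
    · simp [insert_subset_iff, hX, hY, hZ]
    · rw [card_eq_three.2 ⟨X, Y, Z, hXY, hXZ, hYZ, rfl⟩,
        card_eq_three.2 ⟨_, _, _, ne_of_disj d1, (ne_of_disj d3).symm, ne_of_disj d2, rfl⟩]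
    · simp only [mem_insert, mem_singleton, forall_eq_or_imp, forall_eq]
      refine ⟨isNClique_sdiff_union cX cY dXY ?_ ?_ rfl ?_,
        isNClique_sdiff_union cY cZ dYZ ?_ ?_ rfl ?_,
        isNClique_sdiff_union cZ cX dXZ.symm ?_ ?_ rfl ?_⟩ <;>
      simpa only [singleton_subset_iff, mem_singleton, forall_eq]
    · simp only [mem_insert, mem_singleton, forall_eq_or_imp, forall_eq]
      exact ⟨⟨fun h => absurd rfl h, fun _ => d1, fun _ => d3.symm⟩,
        ⟨fun _ => d1.symm, fun h => absurd rfl h, fun _ => d2⟩,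
        fun _ => d3, fun _ => d2.symm, fun h => absurd rfl h⟩
    · intro s hs u hu
      simp only [mem_insert, mem_singleton] at hs
      simp only [biUnion_insert, singleton_biUnion, id, mem_union]
      rcases hs with rfl | rfl | rfl <;>
      · simp only [mem_union, mem_sdiff, mem_singleton] at hu
        rcases hu with hu | rfl <;> tauto
  have hmem : X \ {x} ∪ {y} ∈ P := hsub (mem_insert_self _ _)
  have heq : X \ {x} ∪ {y} = X := by
    by_contra h
    exact Finset.disjoint_left.1 (hP.2.2.1 _ hmem _ hX h)
      (mem_union_left _ (mem_sdiff.2 ⟨haX, hax⟩)) haX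
  exact Finset.disjoint_left.1 dXY (heq ▸ mem_union_right _ (mem_singleton_self y)) hy

variable [DecidableRel G.Adj]

/-- If every vertex of `A` has a non-neighbour in `B`, there are at least `v` non-adjacent pairs,
and if there are exactly `v` then they form a star centred in `B`. -/
lemma nonadjCount_of_forall_exists (hG : WeaklyCP G n v) (hP : IsCliquePartition G n v P)
    (hv : 0 < v) (hA : A ∈ P) (hB : B ∈ P) (hAB : A ≠ B)
    (h : ∀ a ∈ A, ∃ b ∈ B, ¬ G.Adj a b) :
    v ≤ nonadjCount G A B ∧
      (nonadjCount G A B = v → ∃ b ∈ B, ∀ a ∈ A, ¬ G.Adj a b) := by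
  have hAv := (hP.2.1 A hA).card_eq
  have hBv := (hP.2.1 B hB).card_eq
  have hpos : ∀ a ∈ A, 1 ≤ (B.filter fun b => ¬ G.Adj a b).card := by
    intro a ha
    obtain ⟨b, hb, hab⟩ := h a ha
    exact card_pos.2 ⟨b, mem_filter.2 ⟨hb, hab⟩⟩
  have hsum1 : ∑ _a ∈ A, 1 = v := by simp [hAv]
  refine ⟨hsum1 ▸ sum_le_sum hpos, fun hm => ?_⟩
  have hone : ∀ a ∈ A, 1 = (B.filter fun b => ¬ G.Adj a b).card :=
    (sum_eq_sum_iff_of_le hpos).1 (hsum1.trans hm.symm)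
  obtain ⟨a₀, ha₀⟩ := card_pos.1 (hAv.symm ▸ hv)
  obtain ⟨b₀, hb₀, hab₀⟩ := h a₀ ha₀
  set S := A.filter fun a => ¬ G.Adj b₀ a with hSdef
  refine ⟨b₀, hb₀, ?_⟩
  by_contra hnot
  push Not at hnot
  obtain ⟨a₁, ha₁, hab₁⟩ := hnot
  have hS0 : 0 < S.card := card_pos.2 ⟨a₀, mem_filter.2 ⟨ha₀, fun h => hab₀ h.symm⟩⟩
  have hSv : S.card < v := by
    rw [← hAv]
    refine card_lt_card (filter_ssubset.2 ⟨a₁, ha₁, ?_⟩)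
    exact not_not.2 hab₁.symm
  set d : V → ℕ := fun b => (A.filter fun a => ¬ G.Adj b a).card with hd
  have hsum : ∑ b ∈ B, d b = v := by
    rw [← hm, nonadjCount_comm]
    rfl
  set Z := B.filter fun b => d b = 0 with hZ
  have hbound : S.card - 1 ≤ Z.card := by
    have h1 := sum_erase_add B d hb₀
    have h2 : ((B.erase b₀).filter fun b => ¬ d b = 0).card ≤ ∑ b ∈ B.erase b₀, d b := by
      rw [card_filter]
      refine sum_le_sum fun b _ => ?_
      split_ifs <;> omega
    have h3 := card_filter_add_card_filter_not (s := B.erase b₀) (fun b => d b = 0)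
    have h4 := card_erase_of_mem hb₀
    have h5 : ((B.erase b₀).filter fun b => d b = 0).card ≤ Z.card :=
      card_le_card (filter_subset_filter _ (erase_subset _ _))
    have h6 : d b₀ = S.card := rfl
    omega
  obtain ⟨T, hTZ, hTc⟩ := exists_subset_card_eq hbound
  have hb₀T : b₀ ∉ T := fun hb => hS0.ne' (mem_filter.1 (hTZ hb)).2
  refine not_exchangeable hG hP hA hB hAB (S := S) (T := insert b₀ T) (filter_subset _ _)
    (insert_subset hb₀ (hTZ.trans (filter_subset _ _))) ?_ hS0 hSv ?_ ?_
  · rw [card_insert_of_notMem hb₀T]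
    omega
  · intro a ha b hb
    obtain ⟨haA, haS⟩ := mem_sdiff.1 ha
    rcases mem_insert.1 hb with rfl | hb
    · by_contra hc
      exact haS (mem_filter.2 ⟨haA, fun h => hc h.symm⟩)
    · by_contra hc
      have h0 := (mem_filter.1 (hTZ hb)).2
      have : a ∈ A.filter fun a => ¬ G.Adj b a := mem_filter.2 ⟨haA, fun h => hc h.symm⟩
      rw [card_eq_zero.1 h0] at this
      exact notMem_empty _ this
  · intro b hb a ha
    obtain ⟨hbB, hbT⟩ := mem_sdiff.1 hb
    obtain ⟨haA, hab⟩ := mem_filter.1 ha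
    by_contra hc
    have hle := card_le_one.1 (hone a haA).ge b (mem_filter.2 ⟨hbB, fun h => hc h.symm⟩)
      b₀ (mem_filter.2 ⟨hb₀, fun h => hab h.symm⟩)
    exact hbT (hle ▸ mem_insert_self _ _)

lemma nonadjCount_of_mem (hG : WeaklyCP G n v) (hP : IsCliquePartition G n v P)
    (hv : 2 ≤ v) (hA : A ∈ P) (hB : B ∈ P) (hAB : A ≠ B) :
    v ≤ nonadjCount G A B ∧ (nonadjCount G A B = v →
      (∃ a ∈ A, ∀ b ∈ B, ¬ G.Adj a b) ∨ ∃ b ∈ B, ∀ a ∈ A, ¬ G.Adj b a) := by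
  by_cases h : ∀ a ∈ A, ∃ b ∈ B, ¬ G.Adj a b
  · obtain ⟨h1, h2⟩ := nonadjCount_of_forall_exists hG hP (by omega) hA hB hAB h
    exact ⟨h1, fun hm => Or.inr (by simpa only [G.adj_comm] using h2 hm)⟩
  by_cases h' : ∀ b ∈ B, ∃ a ∈ A, ¬ G.Adj b a
  · obtain ⟨h1, h2⟩ := nonadjCount_of_forall_exists hG hP (by omega) hB hA hAB.symm h'
    rw [nonadjCount_comm]
    exact ⟨h1, fun hm => Or.inl (by simpa only [G.adj_comm] using h2 hm)⟩
  push Not at h h'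
  obtain ⟨a, ha, hab⟩ := h
  obtain ⟨b, hb, hba⟩ := h'
  refine (not_exchangeable hG hP hA hB hAB (S := {a}) (T := {b}) (by simpa) (by simpa) rfl
    (by simp) (by simp; omega) ?_ ?_).elim
  · intro c hc t ht
    rw [mem_singleton.1 ht]
    exact (hba c (mem_sdiff.1 hc).1).symm
  · intro c hc t ht
    rw [mem_singleton.1 ht]
    exact (hab c (mem_sdiff.1 hc).1).symm

lemma sum_nonadjCount_le (hP : IsCliquePartition G n v P) :
    ∑ A ∈ P, ∑ B ∈ P.erase A, nonadjCount G A B ≤ 2 * Gᶜ.edgeFinset.card := by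
  obtain ⟨-, -, hPd, hPu⟩ := hP
  rw [← sum_degrees_eq_twice_card_edges, ← hPu, sum_biUnion (t := id) hPd]
  refine sum_le_sum fun A hA => ?_
  unfold nonadjCount
  rw [sum_comm]
  refine sum_le_sum fun a ha => ?_
  rw [← card_biUnion, ← card_neighborFinset_eq_degree]
  · refine card_le_card fun b hb => ?_
    simp only [mem_biUnion, mem_filter, mem_erase] at hb
    obtain ⟨B, ⟨hBA, hB⟩, hbB, hab⟩ := hb
    rw [mem_neighborFinset, compl_adj]
    refine ⟨?_, hab⟩
    rintro rfl
    exact Finset.disjoint_left.1 (hPd B hB A hA hBA) hbB ha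
  · intro B hB C hC hBC
    exact (hPd B (mem_of_mem_erase hB) C (mem_of_mem_erase hC) hBC).mono
      (filter_subset _ _) (filter_subset _ _)

lemma two_mul_card_compl_edgeFinset (hcard : Fintype.card V = n * v)
    (hmax : Nat.card G.edgeSet = (n * v).choose 2 - n * (n - 1) * v / 2) :
    2 * Gᶜ.edgeFinset.card ≤ n * (n - 1) * v := by
  have h1 : G.edgeFinset.card + Gᶜ.edgeFinset.card = (n * v).choose 2 := by
    rw [← hcard, ← card_union_of_disjoint (by
      rw [disjoint_edgeFinset]; exact disjoint_compl_right), ← edgeFinset_sup]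
    convert card_edgeFinset_top_eq_card_choose_two (V := V)
    exact sup_compl_eq_top
  rw [Nat.card_eq_fintype_card, ← edgeFinset_card] at hmax
  omega

/-- In a maximal graph every two cliques have exactly `v` non-adjacent pairs between them. -/
lemma nonadjCount_eq (hG : WeaklyCP G n v)
    (hmax : Nat.card G.edgeSet = (n * v).choose 2 - n * (n - 1) * v / 2)
    (hP : IsCliquePartition G n v P) (hv : 2 ≤ v) (hA : A ∈ P) (hB : B ∈ P) (hAB : A ≠ B) :
    nonadjCount G A B = v := by
  have hle := (sum_nonadjCount_le hP).trans (two_mul_card_compl_edgeFinset hG.1 hmax)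
  have hconst : ∑ A ∈ P, ∑ _B ∈ P.erase A, v = n * (n - 1) * v := by
    rw [sum_congr rfl fun A hA => by rw [sum_const, card_erase_of_mem hA], sum_const, hP.1]
    simp [mul_assoc]
  have hge : ∀ A ∈ P, ∀ B ∈ P.erase A, v ≤ nonadjCount G A B := fun A hA B hB =>
    (nonadjCount_of_mem hG hP hv hA (mem_of_mem_erase hB) (ne_of_mem_erase hB).symm).1
  have hge' : ∀ A ∈ P, ∑ _B ∈ P.erase A, v ≤ ∑ B ∈ P.erase A, nonadjCount G A B :=
    fun A hA => sum_le_sum (hge A hA)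
  have heq := (sum_eq_sum_iff_of_le hge').1 (le_antisymm (sum_le_sum hge') (hconst ▸ hle)) A hA
  exact ((sum_eq_sum_iff_of_le (hge A hA)).1 heq B (mem_erase.2 ⟨hAB.symm, hB⟩)).symm

end Auxiliary

/-- In a maximal weakly `(n,v)`-clique-partitioned graph (`n ≥ 3`),
if `X, Y, Z` are three distinct cliques of the decomposition, `x ∈ X` has no
neighbour in `Y` and `x' ∈ X` has no neighbour in `Z`, then `x = x'`. -/
theorem distinguished_vertex_unique {V : Type} [Fintype V] [DecidableEq V]
    (n v : ℕ) (hn : 3 ≤ n) (hv : 2 ≤ v) (G : SimpleGraph V)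
    (hG : WeaklyCP G n v)
    (hmax : Nat.card G.edgeSet = (n * v).choose 2 - n * (n - 1) * v / 2)
    (P : Finset (Finset V)) (hP : IsCliquePartition G n v P)
    (X Y Z : Finset V) (hX : X ∈ P) (hY : Y ∈ P) (hZ : Z ∈ P)
    (hXY : X ≠ Y) (hXZ : X ≠ Z) (hYZ : Y ≠ Z)
    (x x' : V) (hx : x ∈ X) (hx' : x' ∈ X)
    (h1 : ∀ y ∈ Y, ¬ G.Adj x y) (h2 : ∀ z ∈ Z, ¬ G.Adj x' z) :
    x = x' := by
  classical
  by_contra hne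
  have hcount : ∀ {A B : Finset V}, A ∈ P → B ∈ P → A ≠ B → nonadjCount G A B = B.card :=
    fun hA hB hAB => (nonadjCount_eq hG hmax hP hv hA hB hAB).trans (hP.2.1 _ hB).card_eq.symm
  have hadjY := adj_of_nonadjCount_eq (hcount hX hY hXY) hx h1
  have hadjZ := adj_of_nonadjCount_eq (hcount hX hZ hXZ) hx' h2
  have hxZ : ∀ z ∈ Z, G.Adj z x := fun z hz => (hadjZ x (by simp [hx, hne]) z hz).symm
  have hxY : ∀ y ∈ Y, G.Adj y x' :=
    fun y hy => (hadjY x' (by simp [hx', Ne.symm hne]) y hy).symm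
  have hnonempty : ∀ A ∈ P, A.Nonempty := fun A hA =>
    card_pos.1 (by rw [(hP.2.1 A hA).card_eq]; omega)
  obtain ⟨y₀, hy₀⟩ := hnonempty Y hY
  obtain ⟨z₀, hz₀⟩ := hnonempty Z hZ
  rcases (nonadjCount_of_mem hG hP hv hY hZ hYZ).2 (nonadjCount_eq hG hmax hP hv hY hZ hYZ) with
    ⟨y, hy, hyZ⟩ | ⟨z, hz, hzY⟩
  · have hadj := adj_of_nonadjCount_eq (hcount hY hZ hYZ) hy hyZ
    exact not_cyclically_exchangeable hG hP hv hX hY hZ hXY hXZ hYZ hx hy hz₀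
      (fun a ha => hadjY a ha y hy) (fun a ha => hadj a ha z₀ hz₀)
      (fun a ha => hxZ a (mem_sdiff.1 ha).1)
  · have hadj := adj_of_nonadjCount_eq (hcount hZ hY hYZ.symm) hz hzY
    exact not_cyclically_exchangeable hG hP hv hX hZ hY hXZ hXY hYZ.symm hx' hz hy₀
      (fun a ha => hadjZ a ha z hz) (fun a ha => hadj a ha y₀ hy₀)
      (fun a ha => hxY a (mem_sdiff.1 ha).1)
end

section
/- Let n ≥ 3 and v ≥ 2, let G be a maximal weakly (n,v)-clique-partitioned graph, and let X, Y, Z be three distinct cliques in the unique v-clique decomposition of G. If some vertex of X has no neighbour in Y, and some vertex of Y has no neighbour in Z, then some vertex of X has no neighbour in Z; that is, the tournament on the cliques defined by the relation → is transitive (acyclic). -/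
open SimpleGraph Finset

open scoped Classical in
/-- The number of pairs in `X × Y` that are not adjacent in `G`. -/
noncomputable def nonAdjCard {V : Type} (G : SimpleGraph V) (X Y : Finset V) : ℕ :=
  ∑ x ∈ X, #{y ∈ Y | ¬ G.Adj x y}

theorem nonAdjCard_comm {V : Type} (G : SimpleGraph V) (X Y : Finset V) :
    nonAdjCard G X Y = nonAdjCard G Y X := by
  classical
  have h := Finset.sum_card_bipartiteAbove_eq_sum_card_bipartiteBelow
    (s := X) (t := Y) (fun x y => ¬ G.Adj x y)
  simp only [Finset.bipartiteAbove, Finset.bipartiteBelow] at h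
  simp only [nonAdjCard]
  refine h.trans (Finset.sum_congr rfl fun y _ => ?_)
  simp only [G.adj_comm y]

theorem card_le_nonAdjCard {V : Type} {G : SimpleGraph V} {X Y : Finset V}
    (h : ∀ y ∈ Y, ∃ x ∈ X, ¬ G.Adj x y) :
    #Y ≤ nonAdjCard G X Y := by
  classical
  rw [nonAdjCard_comm, nonAdjCard, Finset.card_eq_sum_ones]
  refine Finset.sum_le_sum fun y hy => Finset.card_pos.mpr ?_
  obtain ⟨x, hx, hxy⟩ := h y hy
  exact ⟨x, by simpa [hx, G.adj_comm] using hxy⟩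

/-- If the non-adjacent pairs between `X` and `Y` are as many as the elements of `Y` and `x ∈ X`
has no neighbour in `Y`, then every other vertex of `X` is adjacent to all of `Y`. -/
theorem adj_of_nonAdjCard_le {V : Type} {G : SimpleGraph V} {X Y : Finset V}
    (hcard : nonAdjCard G X Y ≤ #Y) {x : V} (hx : x ∈ X) (hxY : ∀ y ∈ Y, ¬ G.Adj x y)
    {x' y : V} (hx' : x' ∈ X) (hne : x' ≠ x) (hy : y ∈ Y) :
    G.Adj x' y := by
  classical
  by_contra h
  rw [nonAdjCard, ← Finset.add_sum_erase _ _ hx, Finset.filter_true_of_mem hxY] at hcard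
  have h1 : 0 < #{y ∈ Y | ¬ G.Adj x' y} := Finset.card_pos.mpr ⟨y, by simp [hy, h]⟩
  have h2 := Finset.single_le_sum (f := fun a => #{y ∈ Y | ¬ G.Adj a y})
    (fun _ _ => Nat.zero_le _) (Finset.mem_erase.mpr ⟨hne, hx'⟩)
  omega

/-- Two disjoint finite sets of equal size are exchanged by a permutation fixing everything else. -/
theorem exists_perm_exchange {V : Type} [DecidableEq V] {A B : Finset V} (hAB : Disjoint A B)
    (hcard : #A = #B) : ∃ σ : Equiv.Perm V, (∀ a ∈ A, σ a ∈ B) ∧ (∀ b ∈ B, σ b ∈ A) ∧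
      ∀ c, c ∉ A → c ∉ B → σ c = c := by
  let e : A ≃ B := Finset.equivOfCardEq hcard
  let f : V → V := fun c => if h : c ∈ A then e ⟨c, h⟩ else
    if h : c ∈ B then e.symm ⟨c, h⟩ else c
  have hBA : ∀ b ∈ B, b ∉ A := fun b hb ha => Finset.disjoint_left.mp hAB ha hb
  have hfA : ∀ a (h : a ∈ A), f a = e ⟨a, h⟩ := fun a h => by simp [f, h]
  have hfB : ∀ b (h : b ∈ B), f b = e.symm ⟨b, h⟩ := fun b h => by simp [f, h, hBA b h]
  have hfC : ∀ c, c ∉ A → c ∉ B → f c = c := fun c h h' => by simp [f, h, h']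
  have hf : Function.Involutive f := by
    intro c
    by_cases hA : c ∈ A
    · rw [hfA c hA, hfB _ (e ⟨c, hA⟩).2]; simp
    · by_cases hB : c ∈ B
      · rw [hfB c hB, hfA _ (e.symm ⟨c, hB⟩).2]; simp
      · rw [hfC c hA hB, hfC c hA hB]
  refine ⟨hf.toPerm, fun a ha => ?_, fun b hb => ?_, hfC⟩
  · change f a ∈ B
    rw [hfA a ha]; exact (e ⟨a, ha⟩).2
  · change f b ∈ A
    rw [hfB b hb]; exact (e.symm ⟨b, hb⟩).2

section

variable {V : Type} [Fintype V] [DecidableEq V] {G : SimpleGraph V} {n v : ℕ}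
  {P : Finset (Finset V)} {X Y : Finset V}

/-- A permutation sending every block of a clique partition to a clique yields another
clique partition. -/
theorem IsCliquePartition.image_perm (hP : IsCliquePartition G n v P) (σ : Equiv.Perm V)
    (hσ : ∀ S ∈ P, ∀ a ∈ S, ∀ b ∈ S, a ≠ b → G.Adj (σ a) (σ b)) :
    IsCliquePartition G n v (P.image fun S => S.map σ.toEmbedding) := by
  obtain ⟨hc, hcl, hd, hu⟩ := hP
  refine ⟨?_, ?_, ?_, ?_⟩
  · rw [Finset.card_image_of_injective _ (Finset.map_injective _), hc]
  · intro s hs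
    obtain ⟨S, hS, rfl⟩ := Finset.mem_image.mp hs
    refine ⟨?_, by rw [Finset.card_map]; exact (hcl S hS).2⟩
    intro a ha b hb hab
    simp only [Finset.coe_map, Set.mem_image, Finset.mem_coe] at ha hb
    obtain ⟨a, ha, rfl⟩ := ha
    obtain ⟨b, hb, rfl⟩ := hb
    exact hσ S hS a ha b hb fun h => hab (by rw [h])
  · intro s hs t ht hst
    obtain ⟨S, hS, rfl⟩ := Finset.mem_image.mp hs
    obtain ⟨T, hT, rfl⟩ := Finset.mem_image.mp ht
    rw [Finset.disjoint_map]
    exact hd S hS T hT fun h => hst (by rw [h])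
  · ext c
    have hc' : σ.symm c ∈ P.biUnion id := hu ▸ Finset.mem_univ _
    obtain ⟨S, hS, hcS⟩ := Finset.mem_biUnion.mp hc'
    simp only [Finset.mem_univ, iff_true, Finset.mem_biUnion]
    exact ⟨_, Finset.mem_image_of_mem _ hS, Finset.mem_map.mpr ⟨_, hcS, by simp⟩⟩

theorem IsCliquePartition.eq_of_mem_s16 (hP : IsCliquePartition G n v P) (hX : X ∈ P) (hY : Y ∈ P)
    {a : V} (haX : a ∈ X) (haY : a ∈ Y) : X = Y := by
  by_contra h
  exact Finset.disjoint_left.mp (hP.2.2.1 X hX Y hY h) haX haY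

theorem IsCliquePartition.adj (hP : IsCliquePartition G n v P) (hX : X ∈ P) {a b : V}
    (ha : a ∈ X) (hb : b ∈ X) (hab : a ≠ b) : G.Adj a b :=
  (hP.2.1 X hX).1 ha hb hab

/-- In a weakly clique-partitioned graph, a permutation sending every block to a clique sends
every block to a block. -/
theorem WeaklyCP.perm_rigid (hG : WeaklyCP G n v) (hP : IsCliquePartition G n v P)
    (σ : Equiv.Perm V)
    (hσ : ∀ S ∈ P, ∀ a ∈ S, ∀ b ∈ S, a ≠ b → G.Adj (σ a) (σ b))
    {S T : Finset V} (hS : S ∈ P) (hT : T ∈ P) {a b : V} (ha : a ∈ S) (hb : b ∈ S)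
    (haT : σ a ∈ T) : σ b ∈ T := by
  have hmem : S.map σ.toEmbedding ∈ P := by
    rw [← hG.2.unique (hP.image_perm σ hσ) hP]
    exact Finset.mem_image_of_mem _ hS
  have h := hP.eq_of_mem_s16 hmem hT (Finset.mem_map_of_mem σ.toEmbedding ha) haT
  rw [← h]
  exact Finset.mem_map_of_mem σ.toEmbedding hb

/-- Two blocks of the unique decomposition admit no exchange of proper nonempty subsets that
produces two cliques again. -/
theorem WeaklyCP.not_exchange (hG : WeaklyCP G n v) (hP : IsCliquePartition G n v P)
    (hX : X ∈ P) (hY : Y ∈ P) (hXY : X ≠ Y) {A B : Finset V} (hA : A ⊆ X) (hB : B ⊆ Y)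
    (hcard : #A = #B) (hpos : A.Nonempty) (hlt : #A < v)
    (hXB : ∀ x ∈ X, x ∉ A → ∀ y ∈ B, G.Adj x y)
    (hAY : ∀ x ∈ A, ∀ y ∈ Y, y ∉ B → G.Adj x y) : False := by
  have hd : ∀ c, c ∈ X → c ∉ Y := fun c => by
    exact fun h h' => hXY (hP.eq_of_mem_s16 hX hY h h')
  have hAB : Disjoint A B := Finset.disjoint_left.mpr fun c h h' => hd c (hA h) (hB h')
  obtain ⟨σ, hσA, hσB, hσC⟩ := exists_perm_exchange hAB hcard
  obtain ⟨a, ha⟩ := hpos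
  obtain ⟨x, hxX, hxA⟩ : ∃ x ∈ X, x ∉ A := by
    by_contra! h
    have := Finset.card_le_card (show X ⊆ A from h)
    have := (hP.2.1 X hX).2
    omega
  have hσ : ∀ S ∈ P, ∀ a ∈ S, ∀ b ∈ S, a ≠ b → G.Adj (σ a) (σ b) := by
    intro S hS a ha b hb hab
    have hne : σ a ≠ σ b := fun h => hab (σ.injective h)
    by_cases hSX : S = X
    · subst hSX
      have hB' : ∀ c ∈ S, c ∉ B := fun c hc h => hd c hc (hB h)
      by_cases h1 : a ∈ A <;> by_cases h2 : b ∈ A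
      · exact hP.adj hY (hB (hσA a h1)) (hB (hσA b h2)) hne
      · rw [hσC b h2 (hB' b hb)]
        exact (hXB b hb h2 _ (hσA a h1)).symm
      · rw [hσC a h1 (hB' a ha)]
        exact hXB a ha h1 _ (hσA b h2)
      · rw [hσC a h1 (hB' a ha), hσC b h2 (hB' b hb)]
        exact hP.adj hS ha hb hab
    have hA' : ∀ c ∈ S, c ∉ A := fun c hc h => hSX (hP.eq_of_mem_s16 hS hX hc (hA h))
    by_cases hSY : S = Y
    · subst hSY
      by_cases h1 : a ∈ B <;> by_cases h2 : b ∈ B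
      · exact hP.adj hX (hA (hσB a h1)) (hA (hσB b h2)) hne
      · rw [hσC b (hA' b hb) h2]
        exact hAY _ (hσB a h1) b hb h2
      · rw [hσC a (hA' a ha) h1]
        exact (hAY _ (hσB b h2) a ha h1).symm
      · rw [hσC a (hA' a ha) h1, hσC b (hA' b hb) h2]
        exact hP.adj hS ha hb hab
    have hB' : ∀ c ∈ S, c ∉ B := fun c hc h => hSY (hP.eq_of_mem_s16 hS hY hc (hB h))
    rw [hσC a (hA' a ha) (hB' a ha), hσC b (hA' b hb) (hB' b hb)]
    exact hP.adj hS ha hb hab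
  have h := hG.perm_rigid hP σ hσ hX hY (hA ha) hxX (hB (hσA a ha))
  rw [hσC x hxA fun h => hd x hxX (hB h)] at h
  exact hd x hxX h

theorem WeaklyCP.exists_not_adj (hG : WeaklyCP G n v) (hv : 2 ≤ v)
    (hP : IsCliquePartition G n v P) (hX : X ∈ P) (hY : Y ∈ P) (hXY : X ≠ Y) :
    (∀ y ∈ Y, ∃ x ∈ X, ¬ G.Adj x y) ∨ (∀ x ∈ X, ∃ y ∈ Y, ¬ G.Adj y x) := by
  by_contra! h
  obtain ⟨⟨y, hy, hyX⟩, x, hx, hxY⟩ := h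
  refine hG.not_exchange hP hX hY hXY (A := {x}) (B := {y}) (by simpa) (by simpa) (by simp)
    (by simp) (by rw [Finset.card_singleton]; omega) ?_ ?_
  · intro x' hx' _ y' hy'
    rw [Finset.mem_singleton.mp hy']
    exact hyX x' hx'
  · intro x' hx' y' hy' _
    rw [Finset.mem_singleton.mp hx']
    exact (hxY y' hy').symm

theorem WeaklyCP.le_nonAdjCard (hG : WeaklyCP G n v) (hv : 2 ≤ v)
    (hP : IsCliquePartition G n v P) (hX : X ∈ P) (hY : Y ∈ P) (hXY : X ≠ Y) :
    v ≤ nonAdjCard G X Y := by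
  rcases hG.exists_not_adj hv hP hX hY hXY with h | h
  · exact (hP.2.1 Y hY).2 ▸ card_le_nonAdjCard h
  · rw [nonAdjCard_comm]
    exact (hP.2.1 X hX).2 ▸ card_le_nonAdjCard h

/-- If exactly `v` pairs between two blocks are non-adjacent and they cover the block `Y`, then
they form a star centred in `X`. -/
theorem WeaklyCP.exists_forall_not_adj_of_cover (hG : WeaklyCP G n v) (hv : 2 ≤ v)
    (hP : IsCliquePartition G n v P) (hX : X ∈ P) (hY : Y ∈ P) (hXY : X ≠ Y)
    (hcard : nonAdjCard G X Y = v) (hcov : ∀ y ∈ Y, ∃ x ∈ X, ¬ G.Adj x y) :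
    ∃ x ∈ X, ∀ y ∈ Y, ¬ G.Adj x y := by
  classical
  have hXc := (hP.2.1 X hX).2
  have hYc := (hP.2.1 Y hY).2
  have huniq : ∀ y ∈ Y, ∀ x ∈ X, ∀ x' ∈ X, ¬ G.Adj x y → ¬ G.Adj x' y → x = x' := by
    have hle : ∀ y ∈ Y, 1 ≤ #{x ∈ X | ¬ G.Adj y x} := fun y hy => by
      obtain ⟨x, hx, hxy⟩ := hcov y hy
      exact Finset.card_pos.mpr ⟨x, by simpa [hx, G.adj_comm] using hxy⟩
    have hsum : ∑ y ∈ Y, 1 = ∑ y ∈ Y, #{x ∈ X | ¬ G.Adj y x} := by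
      rw [← Finset.card_eq_sum_ones, hYc, ← hcard, nonAdjCard_comm]
      rfl
    intro y hy x hx x' hx' hxy hxy'
    have h1 := (Finset.sum_eq_sum_iff_of_le hle).mp hsum y hy
    exact Finset.card_le_one.mp h1.ge x (by simpa [hx, G.adj_comm] using hxy) x'
      (by simpa [hx', G.adj_comm] using hxy')
  obtain ⟨y₀, hy₀⟩ : Y.Nonempty := Finset.card_pos.mp (by omega)
  obtain ⟨x, hx, hxy₀⟩ := hcov y₀ hy₀
  set B := {y ∈ Y | ¬ G.Adj x y} with hBdef
  have hBpos : 0 < #B := Finset.card_pos.mpr ⟨y₀, by simp [hBdef, hy₀, hxy₀]⟩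
  have hBY : B ⊆ Y := Finset.filter_subset _ _
  by_cases hBv : #B = v
  · refine ⟨x, hx, fun y hy => ?_⟩
    have : y ∈ B := Finset.eq_of_subset_of_card_le hBY (by omega) ▸ hy
    exact (Finset.mem_filter.mp this).2
  exfalso
  have hBlt : #B < v := lt_of_le_of_ne (hYc ▸ Finset.card_le_card hBY) hBv
  set Z := {x' ∈ X | ∀ y ∈ Y, G.Adj x' y} with hZdef
  have hxZ : x ∉ Z := fun h => hxy₀ ((Finset.mem_filter.mp h).2 y₀ hy₀)
  have hZc : #B - 1 ≤ #Z := by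
    have h1 : ∑ x' ∈ X, 1 + (#B - 1) ≤
        ∑ x' ∈ X, (#{y ∈ Y | ¬ G.Adj x' y} + if x' ∈ Z then 1 else 0) := by
      rw [← Finset.add_sum_erase _ _ hx, ← Finset.add_sum_erase X
        (fun x' => #{y ∈ Y | ¬ G.Adj x' y} + if x' ∈ Z then 1 else 0) hx]
      have : ∑ x' ∈ X.erase x, 1 ≤
          ∑ x' ∈ X.erase x, (#{y ∈ Y | ¬ G.Adj x' y} + if x' ∈ Z then 1 else 0) := by
        refine Finset.sum_le_sum fun x' hx' => ?_
        by_cases h : x' ∈ Z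
        · simp [h]
        · have : ∃ y ∈ Y, ¬ G.Adj x' y := by
            by_contra! h'
            exact h (Finset.mem_filter.mpr ⟨Finset.mem_of_mem_erase hx', h'⟩)
          obtain ⟨y, hy, hxy⟩ := this
          exact le_add_right (Finset.card_pos.mpr ⟨y, by simp [hy, hxy]⟩)
      have hB : #{y ∈ Y | ¬ G.Adj x y} = #B := rfl
      simp only [hxZ, if_false]
      omega
    rw [Finset.sum_add_distrib, ← Finset.card_eq_sum_ones, hXc] at h1
    have h2 : ∑ x' ∈ X, #{y ∈ Y | ¬ G.Adj x' y} = v := hcard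
    have h3 : ∑ x' ∈ X, (if x' ∈ Z then 1 else 0) = #Z := by
      rw [← Finset.card_filter, Finset.filter_mem_eq_inter,
        Finset.inter_eq_right.mpr (Finset.filter_subset _ _)]
    omega
  obtain ⟨D, hDZ, hDc⟩ := Finset.exists_subset_card_eq hZc
  have hxD : x ∉ D := fun h => hxZ (hDZ h)
  have hAc : #(insert x D) = #B := by rw [Finset.card_insert_of_notMem hxD]; omega
  refine hG.not_exchange hP hX hY hXY (A := insert x D) (B := B) ?_ hBY hAc
    (Finset.insert_nonempty _ _) (by omega) ?_ ?_
  · exact Finset.insert_subset hx (hDZ.trans (Finset.filter_subset _ _))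
  · intro x' hx' hxA y hy
    obtain ⟨hyY, hxy⟩ := Finset.mem_filter.mp hy
    by_contra h
    exact hxA (huniq y hyY x' hx' x hx h hxy ▸ Finset.mem_insert_self _ _)
  · intro x' hx' y hy hyB
    rcases Finset.mem_insert.mp hx' with rfl | h
    · by_contra h
      exact hyB (Finset.mem_filter.mpr ⟨hy, h⟩)
    · exact (Finset.mem_filter.mp (hDZ h)).2 y hy

/-- The dichotomy behind the tournament on the blocks. -/
theorem WeaklyCP.exists_forall_not_adj (hG : WeaklyCP G n v) (hv : 2 ≤ v)
    (hP : IsCliquePartition G n v P) (hX : X ∈ P) (hY : Y ∈ P) (hXY : X ≠ Y)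
    (hcard : nonAdjCard G X Y = v) :
    (∃ x ∈ X, ∀ y ∈ Y, ¬ G.Adj x y) ∨ (∃ y ∈ Y, ∀ x ∈ X, ¬ G.Adj y x) := by
  rcases hG.exists_not_adj hv hP hX hY hXY with h | h
  · exact .inl (hG.exists_forall_not_adj_of_cover hv hP hX hY hXY hcard h)
  · exact .inr (hG.exists_forall_not_adj_of_cover hv hP hY hX hXY.symm
      (nonAdjCard_comm G X Y ▸ hcard) h)

theorem IsCliquePartition.sum_nonAdjCard_le (hP : IsCliquePartition G n v P) :
    ∑ p ∈ P.offDiag, nonAdjCard G p.1 p.2 ≤ 2 * Nat.card Gᶜ.edgeSet := by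
  classical
  have hdeg : 2 * Nat.card Gᶜ.edgeSet = #{q : V × V | Gᶜ.Adj q.1 q.2} := by
    rw [Nat.card_eq_fintype_card, ← SimpleGraph.edgeFinset_card,
      ← SimpleGraph.sum_degrees_eq_twice_card_edges]
    simp only [← SimpleGraph.card_neighborFinset_eq_degree, SimpleGraph.neighborFinset_eq_filter]
    rw [Finset.card_filter, Fintype.sum_prod_type]
    simp only [Finset.card_filter]
  have hterm : ∀ S T : Finset V,
      nonAdjCard G S T = #{q ∈ S ×ˢ T | ¬ G.Adj q.1 q.2} := by
    intro S T
    rw [Finset.card_filter, Finset.sum_product]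
    simp only [nonAdjCard, Finset.card_filter]
  simp only [hterm]
  rw [hdeg, ← Finset.card_biUnion]
  · refine Finset.card_le_card fun q hq => ?_
    obtain ⟨p, hp, hq⟩ := Finset.mem_biUnion.mp hq
    obtain ⟨hp1, hp2, hne⟩ := Finset.mem_offDiag.mp hp
    simp only [Finset.mem_filter, Finset.mem_product] at hq
    simp only [Finset.mem_filter, Finset.mem_univ, true_and, SimpleGraph.compl_adj]
    exact ⟨fun h => hne (hP.eq_of_mem_s16 hp1 hp2 hq.1.1 (h ▸ hq.1.2)), hq.2⟩
  · intro p hp p' hp' hne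
    obtain ⟨hp1, hp2, -⟩ := Finset.mem_offDiag.mp hp
    obtain ⟨hp1', hp2', -⟩ := Finset.mem_offDiag.mp hp'
    refine Finset.disjoint_left.mpr fun q hq hq' => hne ?_
    simp only [Finset.mem_filter, Finset.mem_product] at hq hq'
    exact Prod.ext (hP.eq_of_mem_s16 hp1 hp1' hq.1.1 hq'.1.1) (hP.eq_of_mem_s16 hp2 hp2' hq.1.2 hq'.1.2)

theorem card_edgeSet_add_card_edgeSet_compl (G : SimpleGraph V) :
    Nat.card G.edgeSet + Nat.card Gᶜ.edgeSet = (Fintype.card V).choose 2 := by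
  classical
  rw [Nat.card_eq_fintype_card, Nat.card_eq_fintype_card, ← SimpleGraph.edgeFinset_card,
    ← SimpleGraph.edgeFinset_card, ← SimpleGraph.card_edgeFinset_top_eq_card_choose_two,
    ← Finset.card_union_of_disjoint]
  · congr 1
    ext e
    induction e with | _ a b =>
    simp only [Finset.mem_union, SimpleGraph.mem_edgeFinset, SimpleGraph.mem_edgeSet,
      SimpleGraph.compl_adj, SimpleGraph.top_adj]
    have := G.ne_of_adj (a := a) (b := b)
    tauto
  · rw [SimpleGraph.disjoint_edgeFinset]
    exact disjoint_compl_right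

/-- In a maximal weakly clique-partitioned graph any two blocks have exactly `v` non-adjacent
pairs between them. -/
theorem WeaklyCP.nonAdjCard_eq (hG : WeaklyCP G n v) (hv : 2 ≤ v)
    (hmax : Nat.card G.edgeSet = (n * v).choose 2 - n * (n - 1) * v / 2)
    (hP : IsCliquePartition G n v P) (hX : X ∈ P) (hY : Y ∈ P) (hXY : X ≠ Y) :
    nonAdjCard G X Y = v := by
  have hle : ∀ p ∈ P.offDiag, v ≤ nonAdjCard G p.1 p.2 := fun p hp => by
    obtain ⟨h1, h2, h3⟩ := Finset.mem_offDiag.mp hp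
    exact hG.le_nonAdjCard hv hP h1 h2 h3
  have hcompl : 2 * Nat.card Gᶜ.edgeSet ≤ n * (n - 1) * v := by
    have h := card_edgeSet_add_card_edgeSet_compl G
    rw [hG.1, hmax] at h
    have hbound : n * (n - 1) * v / 2 ≤ (n * v).choose 2 := by
      rw [Nat.choose_two_right]
      refine Nat.div_le_div_right ?_
      rw [mul_right_comm]
      refine Nat.mul_le_mul_left _ (Nat.sub_le_sub_right ?_ 1)
      exact Nat.le_mul_of_pos_right n (by omega)
    omega
  have hsum : ∑ p ∈ P.offDiag, v = ∑ p ∈ P.offDiag, nonAdjCard G p.1 p.2 := by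
    refine le_antisymm (Finset.sum_le_sum hle) (hP.sum_nonAdjCard_le.trans (hcompl.trans ?_))
    rw [Finset.sum_const, Finset.offDiag_card, hP.1, smul_eq_mul, Nat.mul_sub_one]
  exact ((Finset.sum_eq_sum_iff_of_le hle).mp hsum (X, Y)
    (Finset.mem_offDiag.mpr ⟨hX, hY, hXY⟩)).symm

end

/-- In a maximal weakly `(n,v)`-clique-partitioned graph (`n ≥ 3`),
the relation `X → Y` ("some vertex of `X` has no neighbour in `Y`") on the cliques
of the decomposition is transitive. -/
theorem clique_tournament_transitive {V : Type} [Fintype V] [DecidableEq V]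
    (n v : ℕ) (hn : 3 ≤ n) (hv : 2 ≤ v) (G : SimpleGraph V)
    (hG : WeaklyCP G n v)
    (hmax : Nat.card G.edgeSet = (n * v).choose 2 - n * (n - 1) * v / 2)
    (P : Finset (Finset V)) (hP : IsCliquePartition G n v P)
    (X Y Z : Finset V) (hX : X ∈ P) (hY : Y ∈ P) (hZ : Z ∈ P)
    (hXY : X ≠ Y) (hXZ : X ≠ Z) (hYZ : Y ≠ Z)
    (hxy : ∃ x ∈ X, ∀ y ∈ Y, ¬ G.Adj x y)
    (hyz : ∃ y ∈ Y, ∀ z ∈ Z, ¬ G.Adj y z) :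
    ∃ x ∈ X, ∀ z ∈ Z, ¬ G.Adj x z := by
  by_contra hxz
  have hcard {S T : Finset V} (hS : S ∈ P) (hT : T ∈ P) (hST : S ≠ T) :
      nonAdjCard G S T = v := hG.nonAdjCard_eq hv hmax hP hS hT hST
  obtain ⟨z, hz, hzX⟩ := (hG.exists_forall_not_adj hv hP hX hZ hXZ (hcard hX hZ hXZ)).resolve_left
    hxz
  obtain ⟨x, hx, hxY⟩ := hxy
  obtain ⟨y, hy, hyZ⟩ := hyz
  have hadj {S T : Finset V} (hS : S ∈ P) (hT : T ∈ P) (hST : S ≠ T) {s : V} (hs : s ∈ S)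
      (hsT : ∀ t ∈ T, ¬ G.Adj s t) {a b : V} (ha : a ∈ S) (hne : a ≠ s) (hb : b ∈ T) :
      G.Adj a b :=
    adj_of_nonAdjCard_le (by rw [hcard hS hT hST, (hP.2.1 T hT).2]) hs hsT ha hne hb
  have hne {S T : Finset V} (hS : S ∈ P) (hT : T ∈ P) (hST : S ≠ T) {a b : V} (ha : a ∈ S)
      (hb : b ∈ T) : a ≠ b := fun h => hST (hP.eq_of_mem_s16 hS hT ha (h ▸ hb))
  have hxy' := hne hX hY hXY hx hy
  have hxz' := hne hX hZ hXZ hx hz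
  have hyz' := hne hY hZ hYZ hy hz
  let σ : Equiv.Perm V := Equiv.swap x y * Equiv.swap y z
  have hσx : σ x = y := by
    simp [σ, Equiv.swap_apply_of_ne_of_ne hxy' hxz']
  have hσy : σ y = z := by
    simp [σ, Equiv.swap_apply_of_ne_of_ne hxz'.symm hyz'.symm]
  have hσz : σ z = x := by simp [σ]
  have hσ : ∀ c, c ≠ x → c ≠ y → c ≠ z → σ c = c := fun c h1 h2 h3 => by
    simp [σ, Equiv.swap_apply_of_ne_of_ne h2 h3, Equiv.swap_apply_of_ne_of_ne h1 h2]
  have hblock {S T : Finset V} (hS : S ∈ P) (hT : T ∈ P) (hST : S ≠ T) {s : V} (hs : s ∈ S)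
      (hsT : ∀ t ∈ T, ¬ G.Adj s t) (hσs : σ s ∈ T) (hfix : ∀ c ∈ S, c ≠ s → σ c = c) :
      ∀ a ∈ S, ∀ b ∈ S, a ≠ b → G.Adj (σ a) (σ b) := by
    intro a ha b hb hab
    by_cases h1 : a = s
    · subst h1
      rw [hfix b hb hab.symm]
      exact (hadj hS hT hST hs hsT hb hab.symm hσs).symm
    · rw [hfix a ha h1]
      by_cases h2 : b = s
      · subst h2
        exact hadj hS hT hST hs hsT ha h1 hσs
      · rw [hfix b hb h2]
        exact hP.adj hS ha hb hab
  have hclique : ∀ S ∈ P, ∀ a ∈ S, ∀ b ∈ S, a ≠ b → G.Adj (σ a) (σ b) := by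
    intro S hS
    by_cases hSX : S = X
    · subst hSX
      exact hblock hX hY hXY hx hxY (hσx ▸ hy) fun c hc h =>
        hσ c h (hne hX hY hXY hc hy) (hne hX hZ hXZ hc hz)
    by_cases hSY : S = Y
    · subst hSY
      exact hblock hY hZ hYZ hy hyZ (hσy ▸ hz) fun c hc h =>
        hσ c (hne hY hX hXY.symm hc hx) h (hne hY hZ hYZ hc hz)
    by_cases hSZ : S = Z
    · subst hSZ
      exact hblock hZ hX hXZ.symm hz hzX (hσz ▸ hx) fun c hc h =>
        hσ c (hne hZ hX hXZ.symm hc hx) (hne hZ hY hYZ.symm hc hy) h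
    intro a ha b hb hab
    have hfix : ∀ c ∈ S, σ c = c := fun c hc =>
      hσ c (hne hS hX hSX hc hx) (hne hS hY hSY hc hy) (hne hS hZ hSZ hc hz)
    rw [hfix a ha, hfix b hb]
    exact hP.adj hS ha hb hab
  obtain ⟨x', hx', hx'x⟩ : ∃ x' ∈ X, x' ≠ x :=
    Finset.exists_mem_ne (by rw [(hP.2.1 X hX).2]; omega) x
  have h := hG.perm_rigid hP σ hclique hX hY hx hx' (hσx ▸ hy)
  rw [hσ x' hx'x (hne hX hY hXY hx' hy) (hne hX hZ hXZ hx' hz)] at h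
  exact hXY (hP.eq_of_mem_s16 hX hY hx' h)
end
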